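/- arXiv:1901.05838 — 5 statements merged into one kernel-verified Lean document; each statement's English description precedes it below -/
import Mathlib

section
/- Let u : ℝ → ℝ be a nonconstant real analytic 2π-periodic function satisfying F(u(φ), u''(φ)) = 0 for all φ ∈ ℝ, where F : ℝ × ℝ → ℝ is real analytic and uniformly elliptic (there is δ > 0 with ∂F/∂q(u,q) ≥ δ for all (u,q)). Suppose every critical point of u is a local extremum point and the extrema of u are leveled. Let φ_1 < φ_2 < ... < φ_N be the critical points of u in [0, 2π), and extend the list by φ_0 := φ_N − 2π and φ_{N+1} := φ_1 + 2π. Then for every i = 1, ..., N one has φ_i = (φ_{i-1} + φ_{i+1})/2, and u(φ) = u(2φ_i − φ) for all φ ∈ ℝ. -/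
/-- Partial derivative of `F : ℝ × ℝ → ℝ` with respect to its second argument `q`. -/
noncomputable def partialQ (F : ℝ × ℝ → ℝ) (p : ℝ × ℝ) : ℝ :=
  deriv (fun q => F (p.1, q)) p.2

open Filter Topology

/-- Uniform ellipticity makes `F` expanding in its second argument. -/
lemma mul_abs_sub_le_of_le_partialQ {F : ℝ × ℝ → ℝ} (hF : Differentiable ℝ F) {δ : ℝ}
    (hell : ∀ p, δ ≤ partialQ F p) (x a b : ℝ) :
    δ * |a - b| ≤ |F (x, a) - F (x, b)| := by
  have hdiff : Differentiable ℝ fun q => F (x, q) := hF.comp (by fun_prop)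
  have key := mul_sub_le_image_sub_of_le_deriv hdiff fun q => hell (x, q)
  rcases le_total a b with h | h
  · rw [abs_sub_comm a, abs_sub_comm (F (x, a)), abs_of_nonneg (sub_nonneg.2 h)]
    exact (key h).trans (le_abs_self _)
  · rw [abs_of_nonneg (sub_nonneg.2 h)]
    exact (key h).trans (le_abs_self _)

/-- Two solutions of `F (u, u'') = 0` with the same Cauchy data at `c` satisfy a linear
differential inequality near `c`. -/
lemma exists_eventually_abs_sub_le {F : ℝ × ℝ → ℝ} (hF : ContDiff ℝ 1 F) {δ : ℝ} (hδ : 0 < δ)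
    (hell : ∀ p, δ ≤ partialQ F p) {u v a b : ℝ → ℝ} {c : ℝ}
    (hu : ContinuousAt u c) (hv : ContinuousAt v c) (hb : ContinuousAt b c)
    (huF : ∀ x, F (u x, a x) = 0) (hvF : ∀ x, F (v x, b x) = 0) (huv : u c = v c) :
    ∃ K : ℝ, ∀ᶠ x in 𝓝 c, |a x - b x| ≤ K * |u x - v x| := by
  obtain ⟨L, s, hs, hL⟩ := hF.contDiffAt.exists_lipschitzOnWith (x := (u c, b c))
  refine ⟨L / δ, ?_⟩
  have hus : ∀ᶠ x in 𝓝 c, (u x, b x) ∈ s := (hu.prodMk hb).eventually_mem hs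
  have hvs : ∀ᶠ x in 𝓝 c, (v x, b x) ∈ s := (hv.prodMk hb).eventually_mem (by rwa [← huv])
  filter_upwards [hus, hvs] with x hx hx'
  have h₁ := mul_abs_sub_le_of_le_partialQ (hF.differentiable one_ne_zero) hell (u x) (a x) (b x)
  have h₂ := hL.dist_le_mul _ hx _ hx'
  rw [Real.dist_eq, hvF, sub_zero, Prod.dist_eq, dist_self, Real.dist_eq,
    max_eq_left (abs_nonneg _)] at h₂
  rw [huF, zero_sub, abs_neg] at h₁
  rw [div_mul_eq_mul_div, le_div_iff₀ hδ]
  linarith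

/-- An analytic function with `|w''| ≤ K |w|` near `c` and zero Cauchy data at `c` vanishes. -/
lemma eq_zero_of_abs_deriv_deriv_le {w : ℝ → ℝ} (hw : ∀ x, AnalyticAt ℝ w x) {c K : ℝ}
    (h0 : w c = 0) (h1 : deriv w c = 0)
    (hK : ∀ᶠ x in 𝓝 c, |deriv (deriv w) x| ≤ K * |w x|) : w = 0 := by
  obtain ⟨ε, hε, hball⟩ := Metric.eventually_nhds_iff.1 hK
  have hd : ∀ x, HasDerivAt (fun y => (w y, deriv w y)) (deriv w x, deriv (deriv w) x) x :=
    fun x => (hw x).differentiableAt.hasDerivAt.prodMk (hw x).deriv.differentiableAt.hasDerivAt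
  have hzero : ∀ x ∈ Set.Icc c (c + ε / 2), w x = 0 := fun x hx => by
    have h := norm_le_gronwallBound_of_norm_deriv_right_le (δ := 0) (ε := 0) (K := max 1 K)
      (fun y _ => (hd y).continuousAt.continuousWithinAt) (fun y _ => (hd y).hasDerivWithinAt)
      (by simp [h0, h1]) (fun y hy => ?_) x hx
    · rw [gronwallBound_ε0, zero_mul] at h
      exact norm_le_zero_iff.1 ((le_max_left _ _).trans h)
    · have hy' : |deriv (deriv w) y| ≤ K * |w y| := hball (by
        rw [Real.dist_eq, abs_lt]; constructor <;> linarith [hy.1, hy.2])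
      simp only [Prod.norm_def, Real.norm_eq_abs, add_zero]
      have hm : 0 ≤ max |w y| |deriv w y| := (abs_nonneg _).trans (le_max_left _ _)
      refine max_le ?_ (hy'.trans ?_)
      · calc |deriv w y| ≤ 1 * max |w y| |deriv w y| := by rw [one_mul]; exact le_max_right _ _
          _ ≤ _ := mul_le_mul_of_nonneg_right (le_max_left _ _) hm
      · exact mul_le_mul (le_max_right _ _) (le_max_left _ _) (abs_nonneg _)
          (zero_le_one.trans (le_max_left _ _))
  have hfreq : ∃ᶠ x in 𝓝[≠] c, w x = 0 := by
    refine Frequently.filter_mono (Eventually.frequently ?_) (nhdsGT_le_nhdsNE c)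
    filter_upwards [Ioo_mem_nhdsGT (by linarith : c < c + ε / 2)] with x hx
    exact hzero x (Set.Ioo_subset_Icc_self hx)
  exact AnalyticOnNhd.eq_of_frequently_eq (fun x _ => hw x) (fun x _ => analyticAt_const) hfreq

/-- An analytic solution of a uniformly elliptic equation `F (u, u'') = 0` is symmetric about
each of its critical points. -/
lemma eq_reflection_of_deriv_eq_zero {F : ℝ × ℝ → ℝ} (hF : ∀ p, AnalyticAt ℝ F p) {δ : ℝ}
    (hδ : 0 < δ) (hell : ∀ p, δ ≤ partialQ F p) {u : ℝ → ℝ} (hu : ∀ x, AnalyticAt ℝ u x)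
    (heq : ∀ x, F (u x, deriv (deriv u) x) = 0) {c : ℝ} (hc : deriv u c = 0) (x : ℝ) :
    u x = u (2 * c - x) := by
  have hv : ∀ y, AnalyticAt ℝ (fun z => u (2 * c - z)) y := fun y =>
    (hu _).comp (analyticAt_const.sub analyticAt_id)
  have hcc : 2 * c - c = c := by ring
  have hd1 : deriv (fun y => u y - u (2 * c - y)) =
      fun y => deriv u y + deriv u (2 * c - y) := funext fun y => by
    rw [deriv_fun_sub (hu y).differentiableAt (hv y).differentiableAt, deriv_comp_const_sub,
      sub_neg_eq_add]
  have hdv : ∀ y, AnalyticAt ℝ (fun z => deriv u (2 * c - z)) y := fun y =>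
    (hu _).deriv.comp (analyticAt_const.sub analyticAt_id)
  have hd2 : ∀ y, deriv (deriv fun y => u y - u (2 * c - y)) y =
      deriv (deriv u) y - deriv (deriv u) (2 * c - y) := fun y => by
    rw [hd1, deriv_fun_add (hu y).deriv.differentiableAt (hdv y).differentiableAt,
      deriv_comp_const_sub, ← sub_eq_add_neg]
  have hb : ContinuousAt (fun y => deriv (deriv u) (2 * c - y)) c :=
    ((hu _).deriv.deriv.comp (analyticAt_const.sub analyticAt_id) : AnalyticAt ℝ
      (fun y => deriv (deriv u) (2 * c - y)) c).continuousAt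
  obtain ⟨K, hK⟩ := exists_eventually_abs_sub_le
    (contDiff_iff_contDiffAt.2 fun p => (hF p).contDiffAt) hδ hell (hu c).continuousAt
    (hv c).continuousAt hb heq (fun y => heq (2 * c - y)) (by simp only [hcc])
  have hw := eq_zero_of_abs_deriv_deriv_le (w := fun y => u y - u (2 * c - y)) (c := c) (K := K)
    (fun y => (hu y).sub (hv y)) (by simp only [hcc, sub_self])
    (by simp only [hd1, hcc, hc, add_zero]) (by simpa only [hd2] using hK)
  exact sub_eq_zero.1 (congrFun hw x)

/-- **Reflectional symmetry, one-dimensional main theorem.**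
A nonconstant real analytic `2π`-periodic solution of `F(u, u'') = 0` with `F`
analytic and uniformly elliptic, whose critical points are all local extrema and
whose extrema are leveled, is reflection-symmetric about each of its critical
points `φ_1 < ... < φ_N` in `[0, 2π)` (extended by `φ_0 := φ_N − 2π`,
`φ_{N+1} := φ_1 + 2π`), and each `φ_i` is the midpoint of its neighbors. -/
theorem reflectional_symmetry_main
    (F : ℝ × ℝ → ℝ) (hFanal : ∀ p : ℝ × ℝ, AnalyticAt ℝ F p)
    (δ : ℝ) (hδ : 0 < δ) (hell : ∀ p : ℝ × ℝ, δ ≤ partialQ F p)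
    (u : ℝ → ℝ) (huanal : ∀ x : ℝ, AnalyticAt ℝ u x)
    (hper : Function.Periodic u (2 * Real.pi))
    (hnonconst : ∃ x y : ℝ, u x ≠ u y)
    (heq : ∀ φ : ℝ, F (u φ, deriv (deriv u) φ) = 0)
    (hextr : ∀ φ : ℝ, deriv u φ = 0 → IsLocalMax u φ ∨ IsLocalMin u φ)
    (hlev : ∃ M m : ℝ, (∀ φ : ℝ, IsLocalMax u φ → u φ = M) ∧
      (∀ φ : ℝ, IsLocalMin u φ → u φ = m))
    (N : ℕ) (hN : 1 ≤ N) (ψ : ℕ → ℝ)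
    (hmono : ∀ i j : ℕ, 1 ≤ i → i < j → j ≤ N → ψ i < ψ j)
    (hcrit : {φ : ℝ | φ ∈ Set.Ico 0 (2 * Real.pi) ∧ deriv u φ = 0} =
      ψ '' (Set.Icc 1 N))
    (hψ0 : ψ 0 = ψ N - 2 * Real.pi)
    (hψN1 : ψ (N + 1) = ψ 1 + 2 * Real.pi) :
    ∀ i : ℕ, 1 ≤ i → i ≤ N →
      ψ i = (ψ (i - 1) + ψ (i + 1)) / 2 ∧
      ∀ φ : ℝ, u φ = u (2 * ψ i - φ) := by
  intro i hi hiN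
  have hsymm : ∀ j, 1 ≤ j → j ≤ N → ∀ φ, u φ = u (2 * ψ j - φ) := fun j hj hjN =>
    eq_reflection_of_deriv_eq_zero hFanal hδ hell huanal heq
      ((Set.ext_iff.1 hcrit (ψ j)).2 ⟨j, ⟨hj, hjN⟩, rfl⟩).2
  refine ⟨?_, hsymm i hi hiN⟩
  have hderiv_per : ∀ x, deriv u (x + 2 * Real.pi) = deriv u x := fun x => by
    rw [← deriv_comp_add_const, funext hper]
  have hmem : ∀ j, 1 ≤ j → j ≤ N → ψ j ∈ Set.Ico 0 (2 * Real.pi) ∧ deriv u (ψ j) = 0 :=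
    fun j hj hjN => (Set.ext_iff.1 hcrit (ψ j)).2 ⟨j, ⟨hj, hjN⟩, rfl⟩
  have hrefl : ∀ x, deriv u x = 0 → deriv u (2 * ψ i - x) = 0 := fun x hx => by
    have h : deriv u x = -deriv u (2 * ψ i - x) := by
      rw [← deriv_comp_const_sub, ← funext (hsymm i hi hiN)]
    linarith
  have hle : ∀ j k, 1 ≤ j → j ≤ k → k ≤ N → ψ j ≤ ψ k := fun j k hj hjk hk => by
    rcases hjk.eq_or_lt with rfl | h
    · rfl
    · exact (hmono j k hj h hk).le
  have hindex : ∀ x, 0 ≤ x → x < 2 * Real.pi → deriv u x = 0 →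
      ∃ k, 1 ≤ k ∧ k ≤ N ∧ ψ k = x := fun x h0 h1 hx => by
    obtain ⟨k, hk, h⟩ := (Set.ext_iff.1 hcrit x).1 ⟨⟨h0, h1⟩, hx⟩
    exact ⟨k, hk.1, hk.2, h⟩
  have hi_mem := (hmem i hi hiN).1
  have h1_mem := (hmem 1 le_rfl hN).1
  have hN_mem := (hmem N hN le_rfl).1
  have hnext : deriv u (ψ (i + 1)) = 0 ∧ ψ i < ψ (i + 1) ∧
      ∀ x, deriv u x = 0 → ψ i < x → ψ (i + 1) ≤ x := by
    rcases hiN.eq_or_lt with rfl | h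
    · rw [hψN1, hderiv_per]
      refine ⟨(hmem 1 le_rfl hN).2, by linarith [hi_mem.2, h1_mem.1], fun x hx hlt => ?_⟩
      by_contra! hcon
      rcases lt_or_ge x (2 * Real.pi) with hx2 | hx2
      · obtain ⟨k, hk, hki, rfl⟩ := hindex x (hi_mem.1.trans hlt.le) hx2 hx
        exact (hle k i hk hki le_rfl).not_gt hlt
      · obtain ⟨k, hk, hki, hkx⟩ := hindex (x - 2 * Real.pi) (by linarith)
          (by linarith [h1_mem.2]) (by rw [← hderiv_per]; simpa using hx)
        linarith [hle 1 k le_rfl hk hki]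
    · refine ⟨(hmem (i + 1) (by omega) h).2, hmono _ _ hi (by omega) h, fun x hx hlt => ?_⟩
      by_contra! hcon
      obtain ⟨k, hk, hkN, rfl⟩ := hindex x (hi_mem.1.trans hlt.le)
        (hcon.trans (hmem (i + 1) (by omega) h).1.2) hx
      rcases le_or_gt k i with hki | hki
      · exact (hle k i hk hki hiN).not_gt hlt
      · exact (hle (i + 1) k (by omega) hki hkN).not_gt hcon
  have hprev : deriv u (ψ (i - 1)) = 0 ∧ ψ (i - 1) < ψ i ∧
      ∀ x, deriv u x = 0 → x < ψ i → x ≤ ψ (i - 1) := by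
    rcases hi.eq_or_lt with rfl | h
    · rw [Nat.sub_self, hψ0]
      refine ⟨by rw [← hderiv_per]; simpa using (hmem N hN le_rfl).2,
        by linarith [hN_mem.2, h1_mem.1], fun x hx hlt => ?_⟩
      by_contra! hcon
      rcases lt_or_ge x 0 with hx0 | hx0
      · obtain ⟨k, hk, hkN, hkx⟩ := hindex (x + 2 * Real.pi) (by linarith [hN_mem.1])
          (by linarith) (by rwa [hderiv_per])
        linarith [hle k N hk hkN le_rfl]
      · obtain ⟨k, hk, hkN, rfl⟩ := hindex x hx0 (hlt.trans h1_mem.2) hx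
        exact (hle 1 k le_rfl hk hkN).not_gt hlt
    · have hp := hmem (i - 1) (by omega) (by omega)
      refine ⟨hp.2, hmono _ _ (by omega) (by omega) hiN, fun x hx hlt => ?_⟩
      by_contra! hcon
      obtain ⟨k, hk, hkN, rfl⟩ := hindex x (hp.1.1.trans hcon.le) (hlt.trans hi_mem.2) hx
      rcases lt_or_ge k i with hki | hki
      · exact (hle k (i - 1) hk (by omega) (by omega)).not_gt hcon
      · exact (hle i k hi hki hkN).not_gt hlt
  have h₁ := hprev.2.2 _ (hrefl _ hnext.1) (by linarith [hnext.2.1])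
  have h₂ := hnext.2.2 _ (hrefl _ hprev.1) (by linarith [hprev.2.1])
  linarith
end

section
/- Let u : ℝ → ℝ be a nonconstant real analytic 2π-periodic function satisfying F(u(φ), u''(φ)) = 0 for all φ ∈ ℝ, where F : ℝ × ℝ → ℝ is real analytic and uniformly elliptic (there is δ > 0 with ∂F/∂q(u,q) ≥ δ for all (u,q)). Suppose every critical point of u is a local extremum point and the extrema of u are leveled. Let φ_{i−1} < φ_i < φ_{i+1} be three consecutive critical points of u (no critical point lies strictly between consecutive ones) such that φ_i is a local maximum point (hence φ_{i−1} and φ_{i+1} are local minimum points). Set φ*_i := min(φ_i − φ_{i−1}, φ_{i+1} − φ_i). Then u(φ) ≤ u(2φ_i − φ) for all φ ∈ [φ_i − φ*_i, φ_i]. -/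
/-- If `F` is differentiable and its partial derivative in the second variable is at least `δ`,
then the second coordinate of a zero of `F` depends on the first one in a Lipschitz way. -/
theorem mul_abs_sub_le_of_le_partialQ_s1 {F : ℝ × ℝ → ℝ} (hF : Differentiable ℝ F) {δ : ℝ}
    (hell : ∀ p : ℝ × ℝ, δ ≤ partialQ F p) {s : Set (ℝ × ℝ)} {K : NNReal}
    (hK : LipschitzOnWith K F s) {a b p q : ℝ} (hap : F (a, p) = 0) (hbq : F (b, q) = 0)
    (haq : (a, q) ∈ s) (hbp : (b, p) ∈ s) (hbq' : (b, q) ∈ s) (hap' : (a, p) ∈ s) :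
    δ * |p - q| ≤ K * |a - b| := by
  have mono (c : ℝ) {x y : ℝ} (hxy : x ≤ y) : δ * (y - x) ≤ F (c, y) - F (c, x) :=
    mul_sub_le_image_sub_of_le_deriv (f := fun r => F (c, r))
      (hF.comp ((differentiable_const c).prodMk differentiable_id)) (fun r => hell (c, r)) hxy
  have lip (r : ℝ) (hb : (b, r) ∈ s) (ha : (a, r) ∈ s) :
      |F (b, r) - F (a, r)| ≤ K * |a - b| := by
    have h := hK.dist_le_mul _ hb _ ha
    rwa [Real.dist_eq, dist_prod_same_right, Real.dist_eq, abs_sub_comm b a] at h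
  rcases le_total p q with h | h
  · have h₁ := mono a h
    have h₂ := lip q hbq' haq
    rw [abs_sub_comm p q, abs_of_nonneg (sub_nonneg.2 h)]
    rw [hbq, zero_sub, abs_neg] at h₂
    linarith [le_abs_self (F (a, q))]
  · have h₁ := mono b h
    have h₂ := lip p hbp hap'
    rw [abs_of_nonneg (sub_nonneg.2 h)]
    rw [hap, sub_zero] at h₂
    linarith [le_abs_self (F (b, p))]

/-- A function with vanishing Cauchy data at `0` satisfying `|w''| ≤ L |w|` on `[0, T]` vanishes
there. -/
theorem eq_zero_of_abs_deriv_deriv_le_s1 {w w' w'' : ℝ → ℝ} {L T : ℝ}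
    (hw : ∀ t, HasDerivAt w (w' t) t) (hw' : ∀ t, HasDerivAt w' (w'' t) t)
    (h₀ : w 0 = 0) (h₀' : w' 0 = 0) (hL : ∀ t ∈ Set.Icc 0 T, |w'' t| ≤ L * |w t|) :
    ∀ t ∈ Set.Icc 0 T, w t = 0 := by
  intro t ht
  have hd (t : ℝ) : HasDerivAt (fun t => (w t, w' t)) (w' t, w'' t) t := (hw t).prodMk (hw' t)
  refine (Prod.mk_eq_zero.1 (eq_zero_of_abs_deriv_le_mul_abs_self_of_eq_zero_right
    (f := fun t => (w t, w' t)) (f' := fun t => (w' t, w'' t)) (K := max 1 L)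
    (fun t _ => (hd t).continuousAt.continuousWithinAt) (fun t _ => (hd t).hasDerivWithinAt)
    (by simp [h₀, h₀']) ?_ t ht)).1
  intro t ht
  have h₁ : |w t| ≤ ‖(w t, w' t)‖ := norm_fst_le (w t, w' t)
  have h₂ : |w' t| ≤ ‖(w t, w' t)‖ := norm_snd_le (w t, w' t)
  rw [Prod.norm_mk, Real.norm_eq_abs, Real.norm_eq_abs]
  refine max_le ?_ ?_
  · calc |w' t| ≤ 1 * ‖(w t, w' t)‖ := by rwa [one_mul]
      _ ≤ _ := by gcongr; exact le_max_left 1 L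
  · calc |w'' t| ≤ L * |w t| := hL t ⟨ht.1, ht.2.le⟩
      _ ≤ max 1 L * |w t| := by gcongr; exact le_max_right 1 L
      _ ≤ _ := by gcongr

/-- A solution of an autonomous elliptic equation `F (u, u'') = 0` is symmetric about each of its
critical points. -/
theorem reflection_eq_of_deriv_eq_zero {F : ℝ × ℝ → ℝ} (hF : ContDiff ℝ 1 F) {δ : ℝ} (hδ : 0 < δ)
    (hell : ∀ p : ℝ × ℝ, δ ≤ partialQ F p) {u : ℝ → ℝ} (hu : ContDiff ℝ 2 u)
    (heq : ∀ x : ℝ, F (u x, deriv (deriv u) x) = 0) {c : ℝ} (hc : deriv u c = 0)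
    {T : ℝ} (hT : 0 ≤ T) : u (c - T) = u (c + T) := by
  have hu' : ContDiff ℝ 1 (deriv u) := by
    have h : ContDiff ℝ (1 + 1) u := by simpa [one_add_one_eq_two] using hu
    exact (contDiff_succ_iff_deriv.1 h).2.2
  have hu'' : Continuous (deriv (deriv u)) := hu'.continuous_deriv le_rfl
  have hd (x : ℝ) : HasDerivAt u (deriv u x) x :=
    (hu.differentiable (by norm_num) x).hasDerivAt
  have hd' (x : ℝ) : HasDerivAt (deriv u) (deriv (deriv u) x) x :=
    (hu'.differentiable (by norm_num) x).hasDerivAt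
  obtain ⟨R, hR⟩ := (isCompact_Icc (a := c - T) (b := c + T)).exists_bound_of_continuousOn
    (hu.continuous.prodMk hu'').continuousOn
  obtain ⟨K, hK⟩ := hF.contDiffOn.exists_lipschitzOnWith one_ne_zero
    (convex_closedBall (0 : ℝ × ℝ) R) (isCompact_closedBall 0 R)
  have mem {x y : ℝ} (hx : x ∈ Set.Icc (c - T) (c + T)) (hy : y ∈ Set.Icc (c - T) (c + T)) :
      (u x, deriv (deriv u) y) ∈ Metric.closedBall (0 : ℝ × ℝ) R := by
    rw [mem_closedBall_zero_iff]
    exact max_le ((norm_fst_le (u x, deriv (deriv u) x)).trans (hR x hx))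
      ((norm_snd_le (u y, deriv (deriv u) y)).trans (hR y hy))
  have key := eq_zero_of_abs_deriv_deriv_le_s1 (w := fun t => u (c - t) - u (c + t))
    (w' := fun t => -deriv u (c - t) - deriv u (c + t))
    (w'' := fun t => deriv (deriv u) (c - t) - deriv (deriv u) (c + t)) (L := K / δ) (T := T)
    (fun t => ((hd (c - t)).comp_const_sub c t).sub ((hd (c + t)).comp_const_add c t))
    (fun t => by
      have h := ((hd' (c - t)).comp_const_sub c t).fun_neg
      rw [neg_neg] at h
      exact h.sub ((hd' (c + t)).comp_const_add c t))
    (by simp) (by simp [hc]) ?_ T ⟨hT, le_rfl⟩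
  · exact sub_eq_zero.1 key
  · intro t ht
    have hm : c - t ∈ Set.Icc (c - T) (c + T) := ⟨by linarith [ht.2], by linarith [ht.1]⟩
    have hp : c + t ∈ Set.Icc (c - T) (c + T) := ⟨by linarith [ht.1], by linarith [ht.2]⟩
    have h := mul_abs_sub_le_of_le_partialQ_s1 (hF.differentiable one_ne_zero) hell hK
      (heq (c - t)) (heq (c + t)) (mem hm hp) (mem hp hm) (mem hp hp) (mem hm hm)
    rw [div_mul_eq_mul_div, le_div_iff₀ hδ, mul_comm]
    exact h

/-- **Inequality for reflections, one-dimensional case.**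
If `φ_{i−1} < φ_i < φ_{i+1}` are consecutive critical points of a nonconstant
analytic `2π`-periodic solution of `F(u, u'') = 0` (F analytic, uniformly
elliptic), with all critical points local extrema, leveled extrema, and `φ_i`
a local maximum, then `u(φ) ≤ u(2φ_i − φ)` on `[φ_i − φ*_i, φ_i]` where
`φ*_i := min(φ_i − φ_{i−1}, φ_{i+1} − φ_i)`. -/
theorem inequality_for_reflections
    (F : ℝ × ℝ → ℝ) (hFanal : ∀ p : ℝ × ℝ, AnalyticAt ℝ F p)
    (δ : ℝ) (hδ : 0 < δ) (hell : ∀ p : ℝ × ℝ, δ ≤ partialQ F p)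
    (u : ℝ → ℝ) (huanal : ∀ x : ℝ, AnalyticAt ℝ u x)
    (hper : Function.Periodic u (2 * Real.pi))
    (hnonconst : ∃ x y : ℝ, u x ≠ u y)
    (heq : ∀ φ : ℝ, F (u φ, deriv (deriv u) φ) = 0)
    (hextr : ∀ φ : ℝ, deriv u φ = 0 → IsLocalMax u φ ∨ IsLocalMin u φ)
    (hlev : ∃ M m : ℝ, (∀ φ : ℝ, IsLocalMax u φ → u φ = M) ∧
      (∀ φ : ℝ, IsLocalMin u φ → u φ = m))
    (φim1 φi φip1 : ℝ) (h1 : φim1 < φi) (h2 : φi < φip1)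
    (hc1 : deriv u φim1 = 0) (hc2 : deriv u φi = 0) (hc3 : deriv u φip1 = 0)
    (hconsec1 : ∀ φ : ℝ, φim1 < φ → φ < φi → deriv u φ ≠ 0)
    (hconsec2 : ∀ φ : ℝ, φi < φ → φ < φip1 → deriv u φ ≠ 0)
    (hmax : IsLocalMax u φi) :
    ∀ φ ∈ Set.Icc (φi - min (φi - φim1) (φip1 - φi)) φi,
      u φ ≤ u (2 * φi - φ) := by
  intro φ hφ
  have hF : ContDiff ℝ 1 F := contDiff_iff_contDiffAt.2 fun p => (hFanal p).contDiffAt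
  have hu : ContDiff ℝ 2 u := contDiff_iff_contDiffAt.2 fun x => (huanal x).contDiffAt
  have h := reflection_eq_of_deriv_eq_zero hF hδ hell hu heq hc2 (sub_nonneg.2 hφ.2)
  rw [sub_sub_cancel, ← add_sub_assoc, ← two_mul] at h
  exact h.le
end

section
/- (Maximum principle for thin domains, one-dimensional case.) Let δ > 0 and B > 0. There exists μ > 0, depending only on δ and B, with the following property: for all real numbers α < β with β − α < μ, all functions a, b : ℝ → ℝ with δ ≤ a(φ) and |b(φ)| ≤ B for all φ ∈ (α, β), and every function w : ℝ → ℝ that is continuous on [α, β], twice differentiable on (α, β), and satisfies a(φ)·w''(φ) + b(φ)·w(φ) = 0 for all φ ∈ (α, β), if w(α) ≤ 0 and w(β) ≤ 0, then w(φ) ≤ 0 for all φ ∈ [α, β]. -/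
/-- Second-derivative test at an interior maximum. -/
theorem IsLocalMax.deriv_deriv_nonpos {f : ℝ → ℝ} {x : ℝ} (h : IsLocalMax f x)
    (hf : ContinuousAt f x) : deriv (deriv f) x ≤ 0 := by
  by_contra! hpos
  have hmin : IsLocalMin f x := isLocalMin_of_deriv_deriv_pos hpos h.deriv_eq_zero hf
  have hconst : f =ᶠ[nhds x] fun _ => f x := by
    filter_upwards [h, hmin] with y hy₁ hy₂ using le_antisymm hy₁ hy₂
  have hzero : deriv (deriv f) x = 0 := by
    rw [hconst.deriv.deriv_eq]
    simp
  exact hpos.ne' hzero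

/-- A function satisfying `w'' ≥ -K w` wherever it is positive, and nonpositive at the endpoints of
an interval carrying a positive strict supersolution `1 - K (x - α)²`, is nonpositive. -/
theorem nonpos_of_neg_mul_le_deriv_deriv {K α β : ℝ} {w : ℝ → ℝ} (hK : 0 < K)
    (hg : ∀ x ∈ Set.Icc α β, 0 < 1 - K * (x - α) ^ 2)
    (hc : ContinuousOn w (Set.Icc α β))
    (hd : ∀ x ∈ Set.Ioo α β, DifferentiableAt ℝ w x)
    (hd₂ : ∀ x ∈ Set.Ioo α β, DifferentiableAt ℝ (deriv w) x)
    (hw : ∀ x ∈ Set.Ioo α β, 0 < w x → -(K * w x) ≤ deriv (deriv w) x)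
    (hα : w α ≤ 0) (hβ : w β ≤ 0) : ∀ x ∈ Set.Icc α β, w x ≤ 0 := by
  intro x hx
  by_contra! hpos
  obtain ⟨m, hm, hmax⟩ := isCompact_Icc.exists_isMaxOn ⟨x, hx⟩
    (hc.div (by fun_prop : ContinuousOn (fun y => 1 - K * (y - α) ^ 2) (Set.Icc α β))
      fun y hy => (hg y hy).ne')
  set t : ℝ := w m / (1 - K * (m - α) ^ 2) with ht
  have ht_pos : 0 < t := (div_pos hpos (hg x hx)).trans_le (hmax hx)
  have hwm : w m = t * (1 - K * (m - α) ^ 2) := (div_mul_cancel₀ _ (hg m hm).ne').symm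
  have hwm_pos : 0 < w m := hwm ▸ mul_pos ht_pos (hg m hm)
  have hm' : m ∈ Set.Ioo α β := by
    refine ⟨lt_of_le_of_ne hm.1 ?_, lt_of_le_of_ne hm.2 ?_⟩
    · rintro rfl
      exact hwm_pos.not_ge hα
    · rintro rfl
      exact hwm_pos.not_ge hβ
  have hnhds : Set.Ioo α β ∈ nhds m := isOpen_Ioo.mem_nhds hm'
  set f : ℝ → ℝ := fun y => w y - t * (1 - K * (y - α) ^ 2) with hf
  have hf_deriv : ∀ y ∈ Set.Ioo α β, HasDerivAt f (deriv w y + 2 * t * K * (y - α)) y := by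
    intro y hy
    refine ((hd y hy).hasDerivAt.sub
      ((((((hasDerivAt_id y).sub_const α).pow 2).const_mul K).const_sub 1).const_mul t)).congr_deriv
        ?_
    simp
    ring
  have hf_max : IsLocalMax f m := by
    filter_upwards [hnhds] with y hy
    have hy' := Set.Ioo_subset_Icc_self hy
    have hle : w y ≤ t * (1 - K * (y - α) ^ 2) := (div_le_iff₀ (hg y hy')).1 (hmax hy')
    simp only [hf]
    linarith
  have hf_deriv₂ : deriv (deriv f) m = deriv (deriv w) m + 2 * t * K := by
    have heq : deriv f =ᶠ[nhds m] fun y => deriv w y + 2 * t * K * (y - α) := by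
      filter_upwards [hnhds] with y hy using (hf_deriv y hy).deriv
    rw [heq.deriv_eq]
    refine (((hd₂ m hm').hasDerivAt.add
      (((hasDerivAt_id m).sub_const α).const_mul (2 * t * K))).congr_deriv ?_).deriv
    ring
  have hnonpos := hf_max.deriv_deriv_nonpos (hf_deriv m hm').continuousAt
  have hlower := hw m hm' hwm_pos
  have htK : 0 < t * K := mul_pos ht_pos hK
  have hsq : 0 ≤ t * K * (K * (m - α) ^ 2) := by positivity
  rw [hwm] at hlower
  nlinarith

/-- **Maximum principle for thin domains, one-dimensional case.**
For `δ, B > 0` there is `μ > 0`, depending only on `δ` and `B`, such that any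
solution of `a·w'' + b·w = 0` on an interval `(α, β)` of length `< μ`, with
`a ≥ δ`, `|b| ≤ B`, which is nonpositive at both endpoints, is nonpositive on
the whole interval `[α, β]`. -/
theorem thin_domain_maximum_principle_1d
    (δ B : ℝ) (hδ : 0 < δ) (hB : 0 < B) :
    ∃ μ > 0, ∀ α β : ℝ, α < β → β - α < μ →
      ∀ a b w : ℝ → ℝ,
        (∀ φ ∈ Set.Ioo α β, δ ≤ a φ) →
        (∀ φ ∈ Set.Ioo α β, |b φ| ≤ B) →
        ContinuousOn w (Set.Icc α β) →
        (∀ φ ∈ Set.Ioo α β, DifferentiableAt ℝ w φ) →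
        (∀ φ ∈ Set.Ioo α β, DifferentiableAt ℝ (deriv w) φ) →
        (∀ φ ∈ Set.Ioo α β, a φ * deriv (deriv w) φ + b φ * w φ = 0) →
        w α ≤ 0 → w β ≤ 0 →
        ∀ φ ∈ Set.Icc α β, w φ ≤ 0 := by
  refine ⟨√(δ / B), Real.sqrt_pos.2 (div_pos hδ hB), ?_⟩
  intro α β _ hlen a b w ha hb hc hd hd₂ heq hα hβ
  refine nonpos_of_neg_mul_le_deriv_deriv (K := B / δ) (div_pos hB hδ) ?_ hc hd hd₂ ?_ hα hβ
  · intro x hx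
    have hlt : (x - α) ^ 2 < δ / B :=
      (Real.lt_sqrt (sub_nonneg.2 hx.1)).1 ((sub_le_sub_right hx.2 α).trans_lt hlen)
    have hmul := mul_lt_mul_of_pos_left hlt (div_pos hB hδ)
    rw [div_mul_div_cancel₀ hδ.ne', div_self hB.ne'] at hmul
    linarith
  · intro x hx hpos
    have ha_pos : 0 < a x := hδ.trans_le (ha x hx)
    have hw'' : deriv (deriv w) x = -(b x / a x * w x) := by
      have := heq x hx
      field_simp
      linarith
    have hba : b x / a x ≤ B / δ :=
      div_le_div₀ hB.le ((le_abs_self _).trans (hb x hx)) hδ (ha x hx)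
    rw [hw'']
    exact neg_le_neg (mul_le_mul_of_nonneg_right hba hpos.le)
end

section
/- (Maximum principle for thin domains, Euclidean case.) Let n ≥ 1 and δ, A, B > 0. There exists μ > 0, depending only on n, δ, A and B, with the following property: for every bounded open set U ⊆ ℝⁿ (Euclidean space) with Lebesgue measure vol(U) < μ, all functions a, b : U → ℝ with δ ≤ a(x) ≤ A and |b(x)| ≤ B for all x ∈ U, and every function w continuous on the closure of U and twice continuously differentiable on U satisfying a(x)·Δw(x) + b(x)·w(x) = 0 for all x ∈ U (Δ the Euclidean Laplacian), if w(x) ≤ 0 for all x in the topological boundary of U, then w(x) ≤ 0 for all x ∈ U. -/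
open MeasureTheory

/-- The Euclidean Laplacian of `u : ℝⁿ → ℝ`, as the sum of the pure second
derivatives in the coordinate directions. -/
noncomputable def euclideanLaplacian {n : ℕ}
    (u : EuclideanSpace ℝ (Fin n) → ℝ) (x : EuclideanSpace ℝ (Fin n)) : ℝ :=
  ∑ i : Fin n, iteratedFDeriv ℝ 2 u x
    ![EuclideanSpace.single i (1:ℝ), EuclideanSpace.single i (1:ℝ)]

open Filter Topology
open scoped NNReal ENNReal

theorem lintegral_enorm_le_volume_support_mul_lintegral_fderiv_of_one
    {u : EuclideanSpace ℝ (Fin 1) → ℝ} (hu : ContDiff ℝ 1 u) (hc : HasCompactSupport u) :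
    ∫⁻ x, ‖u x‖ₑ ≤ volume (Function.support u) * ∫⁻ x, ‖fderiv ℝ u x‖ₑ := by
  let e := (OrthonormalBasis.singleton (Fin 1) ℝ).repr
  have he : MeasurePreserving e volume volume := e.measurePreserving
  have hpt (x : EuclideanSpace ℝ (Fin 1)) : ‖u x‖ₑ ≤ ∫⁻ y, ‖fderiv ℝ u y‖ₑ := by
    have hue : ContDiff ℝ 1 (u ∘ e) := hu.comp e.contDiff
    have hce : HasCompactSupport (u ∘ e) := hc.comp_homeomorph e.toHomeomorph
    have h := HasCompactSupport.enorm_le_lintegral_Ici_deriv hue hce (e.symm x)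
    have hderiv (y : ℝ) : ‖deriv (u ∘ e) y‖ₑ ≤ ‖fderiv ℝ u (e y)‖ₑ := by
      have h1 := ((hu.differentiable one_ne_zero) (e y)).hasFDerivAt.comp_hasDerivAt y
        (e : ℝ →L[ℝ] EuclideanSpace ℝ (Fin 1)).hasDerivAt
      have h2 : deriv (u ∘ e) y = fderiv ℝ u (e y) (e 1) := h1.deriv
      rw [h2, ← ofReal_norm, ← ofReal_norm]
      refine ENNReal.ofReal_le_ofReal ?_
      have hone : ‖e 1‖ = 1 := (e.norm_map 1).trans norm_one
      exact ((fderiv ℝ u (e y)).le_opNorm (e 1)).trans_eq (by rw [hone, mul_one])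
    calc ‖u x‖ₑ = ‖(u ∘ e) (e.symm x)‖ₑ := by simp
      _ ≤ ∫⁻ y in Set.Iic (e.symm x), ‖deriv (u ∘ e) y‖ₑ := h
      _ ≤ ∫⁻ y, ‖deriv (u ∘ e) y‖ₑ := setLIntegral_le_lintegral _ _
      _ ≤ ∫⁻ y, ‖fderiv ℝ u (e y)‖ₑ := lintegral_mono hderiv
      _ = ∫⁻ y, ‖fderiv ℝ u y‖ₑ :=
        he.lintegral_comp (hu.continuous_fderiv one_ne_zero).enorm.measurable
  have hsupp : (Function.support fun x ↦ ‖u x‖ₑ) ⊆ Function.support u := by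
    intro x hx; simpa using hx
  calc ∫⁻ x, ‖u x‖ₑ = ∫⁻ x in Function.support u, ‖u x‖ₑ :=
        (setLIntegral_eq_of_support_subset hsupp).symm
    _ ≤ ∫⁻ _ in Function.support u, ∫⁻ y, ‖fderiv ℝ u y‖ₑ := lintegral_mono hpt
    _ = volume (Function.support u) * ∫⁻ x, ‖fderiv ℝ u x‖ₑ := by
      rw [setLIntegral_const, mul_comm]

/-- An `L¹` Poincaré inequality whose constant is controlled by the measure of the support. -/
theorem exists_lintegral_enorm_le_volume_support_rpow_mul_lintegral_fderiv {n : ℕ} (hn : 1 ≤ n) :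
    ∃ C : ℝ≥0, ∀ u : EuclideanSpace ℝ (Fin n) → ℝ, ContDiff ℝ 1 u → HasCompactSupport u →
      ∫⁻ x, ‖u x‖ₑ ≤ C * volume (Function.support u) ^ (1 / n : ℝ) * ∫⁻ x, ‖fderiv ℝ u x‖ₑ := by
  obtain rfl | hn := hn.eq_or_lt
  · refine ⟨1, fun u hu hc ↦ ?_⟩
    simpa using lintegral_enorm_le_volume_support_mul_lintegral_fderiv_of_one hu hc
  have hn' : (1 : ℝ≥0) < n := mod_cast hn
  have hp : NNReal.HolderConjugate (n : ℝ≥0) (NNReal.conjExponent n) :=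
    NNReal.HolderConjugate.conjExponent hn'
  set p := NNReal.conjExponent n
  refine ⟨eLpNormLESNormFDerivOneConst (volume : Measure (EuclideanSpace ℝ (Fin n))) p,
    fun u hu hc ↦ ?_⟩
  have hsob := eLpNorm_le_eLpNorm_fderiv_one volume hu hc (p := p) (by simpa using hp)
  have hsupp : (Function.support fun x ↦ ‖u x‖ₑ) ⊆ Function.support u := by
    intro x hx; simpa using hx
  have hexp : 1 / (1 : ℝ≥0∞).toReal - 1 / (p : ℝ≥0∞).toReal = 1 / (n : ℝ) := by
    have := hp.coe.inv_add_inv_eq_one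
    simp at this ⊢
    linarith
  have hhol := eLpNorm_le_eLpNorm_mul_rpow_measure_univ (p := 1) (q := p)
    (μ := volume.restrict (Function.support u)) (mod_cast hp.symm.lt.le)
    hu.continuous.aestronglyMeasurable
  rw [hexp, Measure.restrict_apply_univ] at hhol
  calc ∫⁻ x, ‖u x‖ₑ = ∫⁻ x in Function.support u, ‖u x‖ₑ :=
        (setLIntegral_eq_of_support_subset hsupp).symm
    _ = eLpNorm u 1 (volume.restrict (Function.support u)) := eLpNorm_one_eq_lintegral_enorm.symm
    _ ≤ _ := hhol
    _ ≤ _ := by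
      rw [mul_right_comm, ← eLpNorm_one_eq_lintegral_enorm]
      gcongr
      exact (eLpNorm_restrict_le _ _ _ _).trans hsob

/-- For functions supported in sets of small measure, the `L¹` norm is a small multiple of the
`L¹` norm of the gradient. -/
theorem exists_integral_norm_le_mul_integral_norm_fderiv {n : ℕ} (hn : 1 ≤ n) {κ : ℝ}
    (hκ : 0 < κ) :
    ∃ μ > 0, ∀ u : EuclideanSpace ℝ (Fin n) → ℝ, ContDiff ℝ 1 u → HasCompactSupport u →
      volume (Function.support u) ≤ ENNReal.ofReal μ →
      ∫ x, ‖u x‖ ≤ κ * ∫ x, ‖fderiv ℝ u x‖ := by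
  obtain ⟨C, hC⟩ := exists_lintegral_enorm_le_volume_support_rpow_mul_lintegral_fderiv hn
  have hC1 : (0 : ℝ) < C + 1 := by positivity
  refine ⟨(κ / (C + 1)) ^ n, by positivity, fun u hu hc hvol ↦ ?_⟩
  have hroot : volume (Function.support u) ^ (1 / n : ℝ) ≤ ENNReal.ofReal (κ / (C + 1)) := by
    calc volume (Function.support u) ^ (1 / n : ℝ)
        ≤ ENNReal.ofReal ((κ / (C + 1)) ^ n) ^ (1 / n : ℝ) := by gcongr
      _ = ENNReal.ofReal (κ / (C + 1)) := by
        rw [ENNReal.ofReal_rpow_of_pos (by positivity), one_div,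
          Real.pow_rpow_inv_natCast (by positivity) (by omega)]
  have hcoef : (C : ℝ≥0∞) * volume (Function.support u) ^ (1 / n : ℝ) ≤ ENNReal.ofReal κ := by
    calc (C : ℝ≥0∞) * volume (Function.support u) ^ (1 / n : ℝ)
        ≤ ENNReal.ofReal C * ENNReal.ofReal (κ / (C + 1)) := by
          rw [ENNReal.ofReal_coe_nnreal]; gcongr
      _ = ENNReal.ofReal (C * (κ / (C + 1))) := (ENNReal.ofReal_mul C.2).symm
      _ ≤ ENNReal.ofReal κ := by
        refine ENNReal.ofReal_le_ofReal ?_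
        rw [mul_div_assoc', div_le_iff₀ hC1]
        nlinarith
  have hint : Integrable u := hu.continuous.integrable_of_hasCompactSupport hc
  have hint' : Integrable (fderiv ℝ u) :=
    (hu.continuous_fderiv one_ne_zero).integrable_of_hasCompactSupport (hc.fderiv ℝ)
  rw [← ENNReal.ofReal_le_ofReal_iff (by positivity), ENNReal.ofReal_mul hκ.le,
    ofReal_integral_norm_eq_lintegral_enorm hint, ofReal_integral_norm_eq_lintegral_enorm hint']
  exact (hC u hu hc).trans (by gcongr)

theorem hasDerivAt_max_zero_pow (k : ℕ) (s : ℝ) :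
    HasDerivAt (fun s : ℝ ↦ max s 0 ^ (k + 2)) ((k + 2) * max s 0 ^ (k + 1)) s := by
  rcases lt_trichotomy s 0 with hs | rfl | hs
  · have h : (fun s : ℝ ↦ max s 0 ^ (k + 2)) =ᶠ[𝓝 s] fun _ ↦ 0 := by
      filter_upwards [gt_mem_nhds hs] with y hy
      simp [max_eq_right hy.le]
    simpa [max_eq_right hs.le] using (hasDerivAt_const s (0 : ℝ)).congr_of_eventuallyEq h
  · rw [hasDerivAt_iff_isLittleO]
    simp only [max_self, sub_zero, smul_eq_mul, mul_zero, zero_pow (Nat.succ_ne_zero _)]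
    have h1 : (fun s : ℝ ↦ max s 0 ^ (k + 2)) =O[𝓝 0] fun s ↦ s ^ (k + 2) := by
      refine Asymptotics.IsBigO.of_bound 1 (.of_forall fun s ↦ ?_)
      rw [one_mul, norm_pow, norm_pow]
      gcongr
      rcases le_total s 0 with h | h <;> simp [h]
    exact h1.trans_isLittleO (Asymptotics.isLittleO_pow_id (by omega))
  · have h : (fun s : ℝ ↦ max s 0 ^ (k + 2)) =ᶠ[𝓝 s] fun s ↦ s ^ (k + 2) := by
      filter_upwards [lt_mem_nhds hs] with y hy
      simp [max_eq_left hy.le]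
    simpa [max_eq_left hs.le] using (hasDerivAt_pow (k + 2) s).congr_of_eventuallyEq h

theorem contDiff_max_zero_pow (k : ℕ) : ContDiff ℝ 1 fun s : ℝ ↦ max s 0 ^ (k + 2) := by
  rw [contDiff_one_iff_deriv]
  refine ⟨fun s ↦ (hasDerivAt_max_zero_pow k s).differentiableAt, ?_⟩
  rw [show deriv (fun s : ℝ ↦ max s 0 ^ (k + 2)) = fun s : ℝ ↦ (k + 2 : ℝ) * max s 0 ^ (k + 1) from
    funext fun s ↦ (hasDerivAt_max_zero_pow k s).deriv]
  fun_prop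

section CompactSupport

variable {E : Type*} [NormedAddCommGroup E] [NormedSpace ℝ E]

theorem ContDiffOn.contDiff_of_eq_zero_off_compact {f : E → ℝ} {U K : Set E} {m : WithTop ℕ∞}
    (hf : ContDiffOn ℝ m f U) (hU : IsOpen U) (hK : IsCompact K) (hKU : K ⊆ U)
    (h0 : ∀ x ∉ K, f x = 0) : ContDiff ℝ m f := by
  refine contDiff_iff_contDiffAt.2 fun x ↦ ?_
  by_cases hx : x ∈ U
  · exact hf.contDiffAt (hU.mem_nhds hx)
  · have h : f =ᶠ[𝓝 x] fun _ ↦ 0 := by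
      filter_upwards [hK.isClosed.isOpen_compl.mem_nhds fun h ↦ hx (hKU h)] with y hy
      exact h0 y hy
    exact contDiffAt_const.congr_of_eventuallyEq h

theorem HasCompactSupport.integral_fderiv_apply_eq_zero [FiniteDimensional ℝ E]
    [MeasurableSpace E] [BorelSpace E] {μ : Measure E} [μ.IsAddHaarMeasure] {f : E → ℝ}
    (hc : HasCompactSupport f) (hf : ContDiff ℝ 1 f) (v : E) :
    ∫ x, fderiv ℝ f x v ∂μ = 0 := by
  have hint : Integrable (fun x ↦ fderiv ℝ f x v) μ :=
    ((hf.continuous_fderiv one_ne_zero).clm_apply continuous_const).integrable_of_hasCompactSupport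
      (hc.fderiv_apply ℝ v)
  have h := integral_mul_fderiv_eq_neg_fderiv_mul_of_integrable (μ := μ) (f := f)
    (g := fun _ ↦ (1 : ℝ)) (v := v) (by simpa using hint) (by simp)
    (by simpa using hf.continuous.integrable_of_hasCompactSupport hc)
    (fun x _ ↦ hf.differentiable one_ne_zero x) (fun x _ ↦ differentiableAt_const _)
  simpa using h

end CompactSupport

/-- The positive part `(w - ε)⁺` on `U`, extended by zero. -/
noncomputable def truncation {E : Type*} (U : Set E) (w : E → ℝ) (ε : ℝ) : E → ℝ :=
  U.indicator fun x ↦ max (w x - ε) 0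

section Truncation

variable {E : Type*} {U : Set E} {w : E → ℝ} {ε : ℝ}

theorem truncation_of_mem {x : E} (hx : x ∈ U) : truncation U w ε x = max (w x - ε) 0 :=
  Set.indicator_of_mem hx _

theorem truncation_of_notMem {x : E} (hx : x ∉ U) : truncation U w ε x = 0 :=
  Set.indicator_of_notMem hx _

theorem truncation_nonneg (x : E) : 0 ≤ truncation U w ε x :=
  Set.indicator_nonneg (fun _ _ ↦ le_max_right _ _) x

theorem truncation_eq_zero_of_lt {x : E} (hx : w x < ε) : truncation U w ε x = 0 := by
  by_cases hU : x ∈ U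
  · rw [truncation_of_mem hU, max_eq_right (by linarith)]
  · exact truncation_of_notMem hU

theorem truncation_eq_sub {x : E} (hx : truncation U w ε x ≠ 0) :
    truncation U w ε x = w x - ε := by
  have hU : x ∈ U := by_contra fun h ↦ hx (truncation_of_notMem h)
  rw [truncation_of_mem hU] at hx ⊢
  exact max_eq_left (le_of_not_ge fun h ↦ hx (max_eq_right h))

variable [NormedAddCommGroup E] [NormedSpace ℝ E]

theorem hasFDerivAt_truncation_pow (hU : IsOpen U) {x : E} (hx : x ∈ U) (k : ℕ)
    (hw : DifferentiableAt ℝ w x) :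
    HasFDerivAt (fun y ↦ truncation U w ε y ^ (k + 2))
      (((k + 2) * truncation U w ε x ^ (k + 1)) • fderiv ℝ w x) x := by
  rw [truncation_of_mem hx]
  refine ((hasDerivAt_max_zero_pow k (w x - ε)).comp_hasFDerivAt x
    (hw.hasFDerivAt.sub_const ε)).congr_of_eventuallyEq ?_
  filter_upwards [hU.mem_nhds hx] with y hy
  simp [truncation_of_mem hy]

theorem contDiffOn_truncation_pow (k : ℕ) (hw : ContDiffOn ℝ 1 w U) :
    ContDiffOn ℝ 1 (fun x ↦ truncation U w ε x ^ (k + 2)) U := by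
  refine ((contDiff_max_zero_pow k).comp_contDiffOn (hw.sub (contDiffOn_const (c := ε)))).congr fun x hx ↦ ?_
  simp [truncation_of_mem hx]

end Truncation

section SuperlevelSet

variable {E : Type*} [NormedAddCommGroup E] {U : Set E} {w : E → ℝ} {ε : ℝ}

theorem isCompact_closure_inter_superlevel [ProperSpace E] (hb : Bornology.IsBounded U)
    (hw : ContinuousOn w (closure U)) : IsCompact (closure U ∩ w ⁻¹' Set.Ici ε) :=
  hb.isCompact_closure.of_isClosed_subset
    (hw.preimage_isClosed_of_isClosed isClosed_closure isClosed_Ici) Set.inter_subset_left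

theorem closure_inter_superlevel_subset (hU : IsOpen U) (hε : 0 < ε)
    (h : ∀ x ∈ frontier U, w x ≤ 0) : closure U ∩ w ⁻¹' Set.Ici ε ⊆ U := by
  rintro x ⟨hx, hwx⟩
  by_contra hxU
  have := h x (by rw [hU.frontier_eq]; exact ⟨hx, hxU⟩)
  have : ε ≤ w x := hwx
  linarith

theorem truncation_eq_zero_of_notMem_superlevel {x : E}
    (hx : x ∉ closure U ∩ w ⁻¹' Set.Ici ε) : truncation U w ε x = 0 := by
  by_cases hU : x ∈ U
  · exact truncation_eq_zero_of_lt (lt_of_not_ge fun h ↦ hx ⟨subset_closure hU, h⟩)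
  · exact truncation_of_notMem hU

end SuperlevelSet

section EnergyEstimate

variable {n : ℕ} {U : Set (EuclideanSpace ℝ (Fin n))} {w : EuclideanSpace ℝ (Fin n) → ℝ}
  {ε K : ℝ}

theorem contDiff_truncation_pow (hU : IsOpen U) (hb : Bornology.IsBounded U)
    (hw : ContinuousOn w (closure U)) (hw1 : ContDiffOn ℝ 1 w U) (hε : 0 < ε)
    (hfr : ∀ x ∈ frontier U, w x ≤ 0) (k : ℕ) :
    ContDiff ℝ 1 fun x ↦ truncation U w ε x ^ (k + 2) :=
  (contDiffOn_truncation_pow k hw1).contDiff_of_eq_zero_off_compact hU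
    (isCompact_closure_inter_superlevel hb hw) (closure_inter_superlevel_subset hU hε hfr)
    fun x hx ↦ by simp [truncation_eq_zero_of_notMem_superlevel hx]

theorem hasCompactSupport_truncation (hb : Bornology.IsBounded U)
    (hw : ContinuousOn w (closure U)) : HasCompactSupport (truncation U w ε) :=
  HasCompactSupport.intro (isCompact_closure_inter_superlevel hb hw) fun _ hx ↦
    truncation_eq_zero_of_notMem_superlevel hx

theorem HasCompactSupport.pow_succ {X : Type*} [TopologicalSpace X] {f : X → ℝ}
    (hf : HasCompactSupport f) (k : ℕ) : HasCompactSupport fun x ↦ f x ^ (k + 1) :=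
  hf.comp_left (g := fun s : ℝ ↦ s ^ (k + 1)) (by simp)

theorem integrable_truncation_pow (hU : IsOpen U) (hb : Bornology.IsBounded U)
    (hw : ContinuousOn w (closure U)) (hw1 : ContDiffOn ℝ 1 w U) (hε : 0 < ε)
    (hfr : ∀ x ∈ frontier U, w x ≤ 0) (k : ℕ) :
    Integrable fun x ↦ truncation U w ε x ^ (k + 2) :=
  (contDiff_truncation_pow hU hb hw hw1 hε hfr k).continuous.integrable_of_hasCompactSupport
    ((hasCompactSupport_truncation hb hw).pow_succ (k + 1))

theorem fderiv_truncation_pow_three_mul_fderiv_apply (hU : IsOpen U) (hw2 : ContDiffOn ℝ 2 w U)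
    {x : EuclideanSpace ℝ (Fin n)} (hx : x ∈ U) (v : EuclideanSpace ℝ (Fin n)) :
    fderiv ℝ (fun y ↦ truncation U w ε y ^ 3 * fderiv ℝ w y v) x v =
      3 * truncation U w ε x ^ 2 * fderiv ℝ w x v ^ 2 +
        truncation U w ε x ^ 3 * iteratedFDeriv ℝ 2 w x ![v, v] := by
  have hwx : ContDiffAt ℝ 2 w x := hw2.contDiffAt (hU.mem_nhds hx)
  have h1 := hasFDerivAt_truncation_pow (ε := ε) hU hx 1 (hwx.differentiableAt two_ne_zero)
  have h2 : HasFDerivAt (fderiv ℝ w) (fderiv ℝ (fderiv ℝ w) x) x :=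
    ((hwx.fderiv_right (m := 1) (by norm_num)).differentiableAt one_ne_zero).hasFDerivAt
  have h3 := h1.mul (h2.clm_apply (hasFDerivAt_const v x))
  rw [iteratedFDeriv_two_apply]
  refine (congrArg (· v) h3.fderiv).trans ?_
  simp
  ring

theorem norm_fderiv_truncation_pow_four_le (hU : IsOpen U) (hw2 : ContDiffOn ℝ 2 w U)
    (hε : 0 < ε) (hsub : ∀ x ∈ U, 0 ≤ w x → -euclideanLaplacian w x ≤ K * w x)
    {x : EuclideanSpace ℝ (Fin n)} (hx : x ∈ U) :
    ‖fderiv ℝ (fun y ↦ truncation U w ε y ^ 4) x‖ ≤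
      (2 + 2 / 3 * K) * truncation U w ε x ^ 4 + 2 / 3 * K * ε * truncation U w ε x ^ 3 +
        2 / 3 * ∑ i : Fin n, fderiv ℝ (fun y ↦ truncation U w ε y ^ 3 *
          fderiv ℝ w y (EuclideanSpace.single i (1 : ℝ))) x (EuclideanSpace.single i (1 : ℝ)) := by
  have hwx : ContDiffAt ℝ 2 w x := hw2.contDiffAt (hU.mem_nhds hx)
  have ht := truncation_nonneg (U := U) (w := w) (ε := ε) x
  have h4 := (hasFDerivAt_truncation_pow (ε := ε) hU hx 2
    (hwx.differentiableAt two_ne_zero)).fderiv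
  have hnorm : ‖fderiv ℝ w x‖ ^ 2 =
      ∑ i : Fin n, fderiv ℝ w x (EuclideanSpace.single i (1 : ℝ)) ^ 2 := by
    simpa using (EuclideanSpace.basisFun (Fin n) ℝ).norm_dual (fderiv ℝ w x)
  have hdiv : ∑ i : Fin n, fderiv ℝ (fun y ↦ truncation U w ε y ^ 3 *
          fderiv ℝ w y (EuclideanSpace.single i (1 : ℝ))) x (EuclideanSpace.single i (1 : ℝ)) =
      3 * truncation U w ε x ^ 2 * ‖fderiv ℝ w x‖ ^ 2 +
        truncation U w ε x ^ 3 * euclideanLaplacian w x := by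
    simp_rw [fderiv_truncation_pow_three_mul_fderiv_apply hU hw2 hx, Finset.sum_add_distrib,
      ← Finset.mul_sum, hnorm, euclideanLaplacian]
  have hlap : -(truncation U w ε x ^ 3 * euclideanLaplacian w x) ≤
      K * (truncation U w ε x ^ 4 + ε * truncation U w ε x ^ 3) := by
    by_cases h0 : truncation U w ε x = 0
    · simp [h0]
    · have heq := truncation_eq_sub h0
      have := mul_le_mul_of_nonneg_left (hsub x hx (by linarith)) (pow_nonneg ht 3)
      rw [show w x = truncation U w ε x + ε by linarith] at this
      linarith
  rw [h4, hdiv, norm_smul, Real.norm_of_nonneg (by positivity)]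
  norm_num
  nlinarith [mul_nonneg (sq_nonneg (truncation U w ε x))
    (sq_nonneg (truncation U w ε x - ‖fderiv ℝ w x‖))]

theorem integral_norm_fderiv_truncation_pow_four_le (hU : IsOpen U) (hb : Bornology.IsBounded U)
    (hw : ContinuousOn w (closure U)) (hw2 : ContDiffOn ℝ 2 w U) (hε : 0 < ε)
    (hfr : ∀ x ∈ frontier U, w x ≤ 0)
    (hsub : ∀ x ∈ U, 0 ≤ w x → -euclideanLaplacian w x ≤ K * w x) :
    ∫ x, ‖fderiv ℝ (fun y ↦ truncation U w ε y ^ 4) x‖ ≤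
      (2 + 2 / 3 * K) * (∫ x, truncation U w ε x ^ 4) +
        2 / 3 * K * ε * ∫ x, truncation U w ε x ^ 3 := by
  have hw1 : ContDiffOn ℝ 1 w U := hw2.of_le (by norm_num)
  have hcomp := isCompact_closure_inter_superlevel (ε := ε) hb hw
  have hsubset := closure_inter_superlevel_subset hU hε hfr
  let F (i : Fin n) (y : EuclideanSpace ℝ (Fin n)) : ℝ :=
    truncation U w ε y ^ 3 * fderiv ℝ w y (EuclideanSpace.single i (1 : ℝ))
  have hF0 (i) (x) (hx : x ∉ closure U ∩ w ⁻¹' Set.Ici ε) : F i x = 0 := by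
    simp [F, truncation_eq_zero_of_notMem_superlevel hx]
  have hF (i) : ContDiff ℝ 1 (F i) :=
    ((contDiffOn_truncation_pow 1 hw1).mul
      ((hw2.fderiv_of_isOpen hU (by norm_num)).clm_apply
        contDiffOn_const)).contDiff_of_eq_zero_off_compact hU hcomp hsubset (hF0 i)
  have hFc (i) : HasCompactSupport (F i) := HasCompactSupport.intro hcomp (hF0 i)
  have hFint (i) : Integrable fun x ↦ fderiv ℝ (F i) x (EuclideanSpace.single i (1 : ℝ)) :=
    (((hF i).continuous_fderiv one_ne_zero).clm_apply
      continuous_const).integrable_of_hasCompactSupport ((hFc i).fderiv_apply ℝ _)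
  have h3 := integrable_truncation_pow hU hb hw hw1 hε hfr 1
  have h4 := integrable_truncation_pow hU hb hw hw1 hε hfr 2
  have h4' : Integrable (fderiv ℝ fun y ↦ truncation U w ε y ^ 4) :=
    ((contDiff_truncation_pow hU hb hw hw1 hε hfr 2).continuous_fderiv
      one_ne_zero).integrable_of_hasCompactSupport
        (((hasCompactSupport_truncation hb hw).pow_succ 3).fderiv ℝ)
  have hvanish (x : EuclideanSpace ℝ (Fin n)) (hx : x ∉ U)
      {f : EuclideanSpace ℝ (Fin n) → ℝ}
      (hf : ∀ x ∉ closure U ∩ w ⁻¹' Set.Ici ε, f x = 0) : fderiv ℝ f x = 0 := by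
    have h : f =ᶠ[𝓝 x] fun _ ↦ 0 := by
      filter_upwards [hcomp.isClosed.isOpen_compl.mem_nhds fun h ↦ hx (hsubset h)] with y hy
      exact hf y hy
    rw [h.fderiv_eq, fderiv_const_apply]
  have hpt (x : EuclideanSpace ℝ (Fin n)) :
      ‖fderiv ℝ (fun y ↦ truncation U w ε y ^ 4) x‖ ≤
        (2 + 2 / 3 * K) * truncation U w ε x ^ 4 + 2 / 3 * K * ε * truncation U w ε x ^ 3 +
          2 / 3 * ∑ i : Fin n, fderiv ℝ (F i) x (EuclideanSpace.single i (1 : ℝ)) := by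
    by_cases hx : x ∈ U
    · exact norm_fderiv_truncation_pow_four_le hU hw2 hε hsub hx
    · have hz : fderiv ℝ (fun y ↦ truncation U w ε y ^ 4) x = 0 :=
        hvanish x hx fun y hy ↦ by simp [truncation_eq_zero_of_notMem_superlevel hy]
      simp [hz, truncation_of_notMem hx, fun i ↦ hvanish x hx (hF0 i)]
  refine (integral_mono h4'.norm (((h4.const_mul _).add (h3.const_mul _)).add
    ((integrable_finsetSum _ fun i _ ↦ hFint i).const_mul _)) hpt).trans_eq ?_
  rw [integral_add' ((h4.const_mul _).add (h3.const_mul _))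
    ((integrable_finsetSum _ fun i _ ↦ hFint i).const_mul _),
    integral_add' (h4.const_mul _) (h3.const_mul _), integral_const_mul, integral_const_mul,
    integral_const_mul, integral_finsetSum _ fun i _ ↦ hFint i,
    Finset.sum_eq_zero fun i _ ↦ (hFc i).integral_fderiv_apply_eq_zero (hF i) _]
  simp

/-- If the powers of the truncations `t = (w - ε)⁺` satisfy `∫ t⁴ ≤ ε ∫ t³` for all `ε > 0`, then
`w` is nonpositive. -/
theorem nonpos_of_integral_truncation_pow_four_le (hU : IsOpen U) (hb : Bornology.IsBounded U)
    (hw : ContinuousOn w (closure U)) (hw1 : ContDiffOn ℝ 1 w U)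
    (hfr : ∀ x ∈ frontier U, w x ≤ 0)
    (h : ∀ ε > 0, ∫ x, truncation U w ε x ^ 4 ≤ ε * ∫ x, truncation U w ε x ^ 3) :
    ∀ x ∈ U, w x ≤ 0 := by
  intro x₀ hx₀
  by_contra! hM
  set M := w x₀
  set S := U ∩ w ⁻¹' Set.Ioi (M / 2)
  have hSopen : IsOpen S := (hw.mono subset_closure).isOpen_inter_preimage hU isOpen_Ioi
  have hUfin : volume U ≠ ⊤ := hb.measure_lt_top.ne
  have hSfin : volume S ≠ ⊤ := measure_ne_top_of_subset Set.inter_subset_left hUfin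
  have hSpos : 0 < volume.real S := ENNReal.toReal_pos
    (hSopen.measure_pos volume ⟨x₀, hx₀, half_lt_self hM⟩).ne' hSfin
  have key (ε : ℝ) (hε : 0 < ε) (hεM : ε < M / 8) :
      M ^ 4 / 512 * volume.real S ≤ ε ^ 4 * volume.real U := by
    have h3 := integrable_truncation_pow hU hb hw hw1 hε hfr 1
    have h4 := integrable_truncation_pow hU hb hw hw1 hε hfr 2
    have hS : Integrable (S.indicator fun _ ↦ M ^ 4 / 512) :=
      (integrable_indicator_iff hSopen.measurableSet).2 (integrableOn_const hSfin)
    have hUi : Integrable (U.indicator fun _ ↦ ε ^ 4) :=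
      (integrable_indicator_iff hU.measurableSet).2 (integrableOn_const hUfin)
    have hpt (x : EuclideanSpace ℝ (Fin n)) : S.indicator (fun _ ↦ M ^ 4 / 512) x ≤
        truncation U w ε x ^ 4 - ε * truncation U w ε x ^ 3 + U.indicator (fun _ ↦ ε ^ 4) x := by
      have ht := truncation_nonneg (U := U) (w := w) (ε := ε) x
      by_cases hxU : x ∈ U
      · rw [Set.indicator_of_mem hxU]
        by_cases hxS : x ∈ S
        · rw [Set.indicator_of_mem hxS]
          have hwx : M / 2 < w x := hxS.2
          have h1 : M / 4 ≤ truncation U w ε x := by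
            rw [truncation_of_mem hxU]
            exact le_max_of_le_left (by linarith)
          have h2 : (M / 4) ^ 3 * (M / 8) ≤ truncation U w ε x ^ 3 * (truncation U w ε x - ε) := by
            gcongr
            linarith
          nlinarith [pow_pos hε 4]
        · rw [Set.indicator_of_notMem hxS]
          rcases le_total ε (truncation U w ε x) with hle | hle
          · nlinarith [pow_pos hε 4, mul_nonneg (pow_nonneg ht 3) (sub_nonneg.2 hle)]
          · have := pow_le_pow_left₀ ht hle 3
            nlinarith [pow_nonneg ht 4]
      · have hxS : x ∉ S := fun h ↦ hxU h.1
        simp [hxU, hxS, truncation_of_notMem hxU]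
    have hint := integral_mono hS ((h4.sub (h3.const_mul ε)).add hUi) hpt
    rw [integral_add' (h4.sub (h3.const_mul ε)) hUi, integral_sub' h4 (h3.const_mul ε),
      integral_const_mul, integral_indicator_const _ hSopen.measurableSet,
      integral_indicator_const _ hU.measurableSet, smul_eq_mul, smul_eq_mul] at hint
    have := h ε hε
    linarith
  have hlim : Tendsto (fun ε : ℝ ↦ ε ^ 4 * volume.real U) (𝓝[>] 0) (𝓝 0) := by
    have : Continuous fun ε : ℝ ↦ ε ^ 4 * volume.real U := by fun_prop
    simpa using (this.tendsto 0).mono_left nhdsWithin_le_nhds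
  have hle : M ^ 4 / 512 * volume.real S ≤ 0 := by
    refine ge_of_tendsto hlim ?_
    filter_upwards [Ioo_mem_nhdsGT (show (0 : ℝ) < M / 8 by positivity)] with ε hε
    exact key ε hε.1 hε.2
  have : 0 < M ^ 4 / 512 * volume.real S := by positivity
  linarith

end EnergyEstimate

/-- **Maximum principle for thin domains, Euclidean case.**
Given `n ≥ 1` and `δ, A, B > 0`, there is `μ > 0`, depending only on
`n, δ, A, B`, such that any solution of `a·Δw + b·w = 0` on a bounded open set
`U ⊆ ℝⁿ` of Lebesgue measure `< μ`, with `δ ≤ a ≤ A` and `|b| ≤ B`, which is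
nonpositive on the boundary of `U`, is nonpositive on `U`. -/
theorem thin_domain_maximum_principle_euclidean
    (n : ℕ) (hn : 1 ≤ n) (δ A B : ℝ) (hδ : 0 < δ) (hA : 0 < A) (hB : 0 < B) :
    ∃ μ > 0, ∀ U : Set (EuclideanSpace ℝ (Fin n)),
      IsOpen U → Bornology.IsBounded U →
      volume U < ENNReal.ofReal μ →
      ∀ a b w : EuclideanSpace ℝ (Fin n) → ℝ,
        (∀ x ∈ U, δ ≤ a x ∧ a x ≤ A) →
        (∀ x ∈ U, |b x| ≤ B) →
        ContinuousOn w (closure U) →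
        ContDiffOn ℝ 2 w U →
        (∀ x ∈ U, a x * euclideanLaplacian w x + b x * w x = 0) →
        (∀ x ∈ frontier U, w x ≤ 0) →
        ∀ x ∈ U, w x ≤ 0 := by
  set K := B / δ
  have hK : 0 < K := by positivity
  obtain ⟨μ, hμ, hpoinc⟩ := exists_integral_norm_le_mul_integral_norm_fderiv hn
    (κ := 1 / (4 + 2 * K)) (by positivity)
  refine ⟨μ, hμ, fun U hU hb hvol a b w ha hbb hw hw2 heq hfr ↦ ?_⟩
  have hw1 : ContDiffOn ℝ 1 w U := hw2.of_le (by norm_num)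
  have hsub : ∀ x ∈ U, 0 ≤ w x → -euclideanLaplacian w x ≤ K * w x := by
    intro x hx hwx
    have hbw : b x * w x ≤ B * w x :=
      mul_le_mul_of_nonneg_right ((le_abs_self _).trans (hbb x hx)) hwx
    rcases le_total (-euclideanLaplacian w x) 0 with h | h
    · exact h.trans (by positivity)
    · rw [div_mul_eq_mul_div, le_div_iff₀ hδ]
      nlinarith [heq x hx, mul_le_mul_of_nonneg_right (ha x hx).1 h]
  refine nonpos_of_integral_truncation_pow_four_le hU hb hw hw1 hfr fun ε hε ↦ ?_
  have hsupp : (Function.support fun x ↦ truncation U w ε x ^ 4) ⊆ U := by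
    intro x hx
    by_contra hxU
    simp [truncation_of_notMem hxU] at hx
  have h1 := hpoinc _ (contDiff_truncation_pow hU hb hw hw1 hε hfr 2)
    ((hasCompactSupport_truncation hb hw).pow_succ 3) ((measure_mono hsupp).trans hvol.le)
  have h2 := integral_norm_fderiv_truncation_pow_four_le hU hb hw hw2 hε hfr hsub
  have hnorm (x) : ‖truncation U w ε x ^ 4‖ = truncation U w ε x ^ 4 :=
    Real.norm_of_nonneg (by positivity)
  simp only [Nat.reduceAdd, hnorm] at h1
  rw [one_div_mul_eq_div, le_div_iff₀ (by positivity)] at h1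
  set I₃ := ∫ x, truncation U w ε x ^ 3
  set I₄ := ∫ x, truncation U w ε x ^ 4
  have hI₃ : 0 ≤ I₃ := integral_nonneg fun x ↦ pow_nonneg (truncation_nonneg x) 3
  have hI₄ : 0 ≤ I₄ := integral_nonneg fun x ↦ by positivity
  have h3 : (2 + 4 / 3 * K) * I₄ ≤ (2 + 4 / 3 * K) * (ε * I₃) := by
    nlinarith [mul_nonneg hK.le (mul_nonneg hε.le hI₃), mul_nonneg hε.le hI₃]
  exact le_of_mul_le_mul_left h3 (by positivity)
end

section
/- (Strong unique continuation, Euclidean case.) Let U ⊆ ℝⁿ (Euclidean space) be open and connected, let a : U → ℝ be continuously differentiable with a(x) ≥ δ > 0 for all x ∈ U, let b : U → ℝ be continuous and bounded, and let w : U → ℝ be twice continuously differentiable satisfying a(x)·Δw(x) + b(x)·w(x) = 0 for all x ∈ U, where Δ is the Euclidean Laplacian. If w vanishes identically on some nonempty open subset V ⊆ U, then w vanishes identically on U. -/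
namespace UniqueContinuation

open MeasureTheory Metric Filter Topology

/-- `f` is Fréchet differentiable at `x`, with partial derivative `f'` in the `i`-th coordinate
direction. -/
def HasPartialDerivAt {n : ℕ} (i : Fin n) (f : EuclideanSpace ℝ (Fin n) → ℝ) (f' : ℝ)
    (x : EuclideanSpace ℝ (Fin n)) : Prop :=
  ∃ L : EuclideanSpace ℝ (Fin n) →L[ℝ] ℝ, HasFDerivAt f L x ∧ L (EuclideanSpace.single i 1) = f'

/-- The partial derivative in the `i`-th coordinate direction. -/
noncomputable def partialDeriv {n : ℕ} (i : Fin n) (f : EuclideanSpace ℝ (Fin n) → ℝ)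
    (x : EuclideanSpace ℝ (Fin n)) : ℝ :=
  fderiv ℝ f x (EuclideanSpace.single i 1)

section Calculus

variable {n : ℕ} {i : Fin n} {f g : EuclideanSpace ℝ (Fin n) → ℝ} {f' g' : ℝ}
  {x : EuclideanSpace ℝ (Fin n)}

theorem HasPartialDerivAt.partialDeriv_eq (h : HasPartialDerivAt i f f' x) :
    partialDeriv i f x = f' := by
  obtain ⟨L, hL, rfl⟩ := h
  rw [partialDeriv, hL.fderiv]

theorem hasPartialDerivAt_of_differentiableAt (h : DifferentiableAt ℝ f x) :
    HasPartialDerivAt i f (partialDeriv i f x) x :=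
  ⟨_, h.hasFDerivAt, rfl⟩

theorem HasPartialDerivAt.congr_deriv (h : HasPartialDerivAt i f f' x) (h' : f' = g') :
    HasPartialDerivAt i f g' x := h' ▸ h

theorem HasPartialDerivAt.add (hf : HasPartialDerivAt i f f' x) (hg : HasPartialDerivAt i g g' x) :
    HasPartialDerivAt i (fun y => f y + g y) (f' + g') x := by
  obtain ⟨L, hL, rfl⟩ := hf
  obtain ⟨M, hM, rfl⟩ := hg
  exact ⟨_, hL.add hM, rfl⟩

theorem HasPartialDerivAt.sub (hf : HasPartialDerivAt i f f' x) (hg : HasPartialDerivAt i g g' x) :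
    HasPartialDerivAt i (fun y => f y - g y) (f' - g') x := by
  obtain ⟨L, hL, rfl⟩ := hf
  obtain ⟨M, hM, rfl⟩ := hg
  exact ⟨_, hL.sub hM, rfl⟩

theorem HasPartialDerivAt.mul (hf : HasPartialDerivAt i f f' x) (hg : HasPartialDerivAt i g g' x) :
    HasPartialDerivAt i (fun y => f y * g y) (f' * g x + f x * g') x := by
  obtain ⟨L, hL, rfl⟩ := hf
  obtain ⟨M, hM, rfl⟩ := hg
  refine ⟨_, hL.mul hM, ?_⟩
  simp
  ring

theorem HasPartialDerivAt.exp (hf : HasPartialDerivAt i f f' x) :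
    HasPartialDerivAt i (fun y => Real.exp (f y)) (Real.exp (f x) * f') x := by
  obtain ⟨L, hL, rfl⟩ := hf
  exact ⟨_, hL.exp, rfl⟩

theorem hasPartialDerivAt_const (c : ℝ) :
    HasPartialDerivAt i (fun _ => c) 0 x :=
  ⟨0, hasFDerivAt_const c x, rfl⟩

theorem HasPartialDerivAt.const_mul (c : ℝ) (hf : HasPartialDerivAt i f f' x) :
    HasPartialDerivAt i (fun y => c * f y) (c * f') x :=
  ((hasPartialDerivAt_const c).mul hf).congr_deriv (by ring)

theorem HasPartialDerivAt.sum {ι : Type*} {s : Finset ι} {F : ι → EuclideanSpace ℝ (Fin n) → ℝ}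
    {F' : ι → ℝ} (h : ∀ j ∈ s, HasPartialDerivAt i (F j) (F' j) x) :
    HasPartialDerivAt i (fun y => ∑ j ∈ s, F j y) (∑ j ∈ s, F' j) x := by
  classical
  induction s using Finset.induction_on with
  | empty => simpa using hasPartialDerivAt_const 0
  | insert a s ha ih =>
    simp only [Finset.sum_insert ha]
    exact (h a (Finset.mem_insert_self a s)).add
      (ih fun j hj => h j (Finset.mem_insert_of_mem hj))

theorem hasPartialDerivAt_coord_sub (c : EuclideanSpace ℝ (Fin n)) (j : Fin n) :
    HasPartialDerivAt i (fun y => y j - c j) (if j = i then 1 else 0) x :=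
  ⟨_, (EuclideanSpace.proj (𝕜 := ℝ) j).hasFDerivAt.sub_const (c j), by simp⟩

theorem hasPartialDerivAt_sum_sq (c : EuclideanSpace ℝ (Fin n)) :
    HasPartialDerivAt i (fun y => ∑ j, (y j - c j) * (y j - c j)) (2 * (x i - c i)) x := by
  refine (HasPartialDerivAt.sum fun j _ =>
    (hasPartialDerivAt_coord_sub c j).mul (hasPartialDerivAt_coord_sub c j)).congr_deriv ?_
  simp [Finset.sum_add_distrib]
  ring

theorem contDiff_partialDeriv {k m : WithTop ℕ∞} (hf : ContDiff ℝ k f) (h : m + 1 ≤ k) :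
    ContDiff ℝ m (partialDeriv i f) :=
  (hf.fderiv_right h).clm_apply contDiff_const

theorem partialDeriv_comm (hf : ContDiff ℝ 2 f) (j : Fin n) :
    partialDeriv i (partialDeriv j f) x = partialDeriv j (partialDeriv i f) x := by
  have hd : DifferentiableAt ℝ (fderiv ℝ f) x :=
    ((hf.fderiv_right (m := 1) (by norm_num)).differentiable (by norm_num)) x
  have key (k l : Fin n) : partialDeriv k (partialDeriv l f) x =
      fderiv ℝ (fderiv ℝ f) x (EuclideanSpace.single k 1) (EuclideanSpace.single l 1) := by
    unfold partialDeriv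
    rw [fderiv_clm_apply hd (by fun_prop)]
    simp
  rw [key, key]
  exact (hf.contDiffAt.isSymmSndFDerivAt (by simp)) _ _

theorem euclideanLaplacian_eq_sum_partialDeriv (hf : ContDiff ℝ 2 f) :
    euclideanLaplacian f x = ∑ i, partialDeriv i (partialDeriv i f) x := by
  have hd : DifferentiableAt ℝ (fderiv ℝ f) x :=
    ((hf.fderiv_right (m := 1) (by norm_num)).differentiable (by norm_num)) x
  refine Finset.sum_congr rfl fun i _ => ?_
  rw [iteratedFDeriv_two_apply]
  unfold partialDeriv
  rw [fderiv_clm_apply hd (by fun_prop)]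
  simp

theorem hasCompactSupport_partialDeriv (hf : HasCompactSupport f) :
    HasCompactSupport (partialDeriv i f) :=
  (hf.fderiv_apply (𝕜 := ℝ) _)

theorem partialDeriv_eq_zero_of_notMem_tsupport (hx : x ∉ tsupport f) : partialDeriv i f x = 0 := by
  have : fderiv ℝ f x = 0 := by
    by_contra h
    exact hx (support_fderiv_subset ℝ h)
  simp [partialDeriv, this]

theorem integral_partialDeriv_eq_zero (hf : ContDiff ℝ 1 f) (hc : HasCompactSupport f) :
    ∫ x, partialDeriv i f x = 0 := by
  have h := integral_mul_fderiv_eq_neg_fderiv_mul_of_integrable (𝕜 := ℝ)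
    (μ := (volume : Measure (EuclideanSpace ℝ (Fin n)))) (f := fun _ => (1 : ℝ)) (g := f)
    (v := EuclideanSpace.single i 1) (by simp)
    (by
      simp only [one_mul]
      exact (contDiff_partialDeriv (i := i) (m := 0) hf (by simp)).continuous
        |>.integrable_of_hasCompactSupport (hasCompactSupport_partialDeriv hc))
    (by simpa using hf.continuous.integrable_of_hasCompactSupport hc)
    (fun _ _ => by fun_prop) (fun x _ => hf.differentiable (by norm_num) x)
  simpa [partialDeriv] using h

end Calculus

/-- Summed over the coordinates, the derivatives of the flux components in the Carleman identity
give the cross term minus a quadratic form. -/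
theorem carleman_algebra {n : ℕ} (y p : Fin n → ℝ) (H : Fin n → Fin n → ℝ)
    (hH : ∀ i j, H i j = H j i) (v s τ γ X N D : ℝ) (hX : X = ∑ i, y i * y i)
    (hN : N = ∑ i, p i * p i) (hD : D = ∑ i, y i * p i) :
    ∑ i, ((-2 * τ) * (H i i * s * D + p i * (2 * y i) * D + p i * s * (p i + ∑ j, y j * H i j))
      + τ * (2 * y i * y i * N + s * N + s * y i * (2 * ∑ j, p j * H i j))
      - τ * ((2 * n + 4) * y i * v * p i + (n * s + 2 * X + γ) * (p i * p i)
        + (n * s + 2 * X + γ) * v * H i i)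
      + τ * (n + 2) * (2 * v * p i * y i + v * v)
      - τ * (τ ^ 2 * (4 * s * y i * X + s * s * (2 * y i)) * s * y i * (v * v)
        + (τ ^ 2 * (s * s * X) + τ * γ) * (2 * y i * y i + s) * (v * v)
        + (τ ^ 2 * (s * s * X) + τ * γ) * s * y i * (2 * v * p i)))
    = (∑ i, H i i + τ ^ 2 * s ^ 2 * X * v + τ * γ * v)
        * (-2 * τ * s * D - τ * (n * s + 2 * X + γ) * v)
      - (2 * τ * (s * N + 2 * D ^ 2) + τ * γ * N
        + τ ^ 3 * s ^ 2 * X * (2 * s + 4 * X - γ) * v ^ 2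
        - τ * n * (n + 2) * v ^ 2 - τ ^ 2 * γ ^ 2 * v ^ 2) := by
  have hS : ∑ i, p i * ∑ j, y j * H i j = ∑ i, y i * ∑ j, p j * H i j := by
    simp only [Finset.mul_sum]
    rw [Finset.sum_comm]
    refine Finset.sum_congr rfl fun i _ => Finset.sum_congr rfl fun j _ => ?_
    rw [hH]; ring
  set S := ∑ i, y i * ∑ j, p j * H i j with hSdef
  set T := ∑ i, H i i with hT
  have key : ∀ a b c d e f g : ℝ, ∑ i, (a * H i i + b * (y i * p i) + c * (p i * p i)
      + d * (p i * ∑ j, y j * H i j) + e * (y i * ∑ j, p j * H i j) + f * (y i * y i) + g)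
      = a * T + b * D + c * N + d * S + e * S + f * X + n * g := by
    intro a b c d e f g
    simp only [Finset.sum_add_distrib, ← Finset.mul_sum, hS, ← hSdef, ← hX, ← hN, ← hD, ← hT]
    simp
  trans ∑ i, ((-2 * τ * s * D - τ * (n * s + 2 * X + γ) * v) * H i i
      + (-4 * τ * D - τ * (2 * n + 4) * v + 2 * τ * (n + 2) * v
        - 2 * τ * (τ ^ 2 * (s * s * X) + τ * γ) * s * v) * (y i * p i)
      + (-2 * τ * s - τ * (n * s + 2 * X + γ)) * (p i * p i)
      + (-2 * τ * s) * (p i * ∑ j, y j * H i j)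
      + (2 * τ * s) * (y i * ∑ j, p j * H i j)
      + (2 * τ * N - τ * (τ ^ 2 * (4 * s * X + 2 * s * s) * s * v * v)
        - 2 * τ * (τ ^ 2 * (s * s * X) + τ * γ) * v * v) * (y i * y i)
      + (τ * s * N + τ * (n + 2) * v * v - τ * (τ ^ 2 * (s * s * X) + τ * γ) * s * v * v))
  · refine Finset.sum_congr rfl fun i _ => ?_
    ring
  · rw [key]
    ring

/-- The squared distance to `c`, in coordinates. -/
noncomputable def sqDist {n : ℕ} (c x : EuclideanSpace ℝ (Fin n)) : ℝ :=
  ∑ j, (x j - c j) * (x j - c j)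

theorem sqDist_eq {n : ℕ} (c x : EuclideanSpace ℝ (Fin n)) : sqDist c x = dist x c ^ 2 := by
  rw [EuclideanSpace.dist_eq, Real.sq_sqrt (Finset.sum_nonneg fun _ _ => sq_nonneg _), sqDist]
  refine Finset.sum_congr rfl fun j _ => ?_
  rw [Real.dist_eq, sq_abs, sq]

theorem contDiff_sqDist {n : ℕ} (c : EuclideanSpace ℝ (Fin n)) {k : WithTop ℕ∞} :
    ContDiff ℝ k (sqDist c) := by
  unfold sqDist
  fun_prop

/-- The Carleman weight `exp (τ φ)`, where `φ = (|x - c|² - r)² / 4`. -/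
noncomputable def weight {n : ℕ} (τ r : ℝ) (c x : EuclideanSpace ℝ (Fin n)) : ℝ :=
  Real.exp (τ / 4 * ((sqDist c x - r) * (sqDist c x - r)))

theorem contDiff_weight {n : ℕ} (τ r : ℝ) (c : EuclideanSpace ℝ (Fin n)) {k : WithTop ℕ∞} :
    ContDiff ℝ k (weight τ r c) := by
  unfold weight
  have := contDiff_sqDist c (k := k)
  fun_prop

/-- The symmetric part of the Laplacian conjugated with `weight τ r c`, shifted by `τ γ`. -/
noncomputable def symmPart {n : ℕ} (τ r γ : ℝ) (c : EuclideanSpace ℝ (Fin n))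
    (v : EuclideanSpace ℝ (Fin n) → ℝ) (x : EuclideanSpace ℝ (Fin n)) : ℝ :=
  ∑ i, partialDeriv i (partialDeriv i v) x
    + τ ^ 2 * (sqDist c x - r) ^ 2 * sqDist c x * v x + τ * γ * v x

/-- The antisymmetric part of the Laplacian conjugated with `weight τ r c`, shifted by `-τ γ`. -/
noncomputable def skewPart {n : ℕ} (τ r γ : ℝ) (c : EuclideanSpace ℝ (Fin n))
    (v : EuclideanSpace ℝ (Fin n) → ℝ) (x : EuclideanSpace ℝ (Fin n)) : ℝ :=
  -2 * τ * (sqDist c x - r) * (∑ i, (x i - c i) * partialDeriv i v x)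
    - τ * (n * (sqDist c x - r) + 2 * sqDist c x + γ) * v x

/-- The quadratic form in `v` and its gradient that has the same integral as
`symmPart * skewPart`. -/
noncomputable def carlemanForm {n : ℕ} (τ r γ : ℝ) (c : EuclideanSpace ℝ (Fin n))
    (v : EuclideanSpace ℝ (Fin n) → ℝ) (x : EuclideanSpace ℝ (Fin n)) : ℝ :=
  2 * τ * ((sqDist c x - r) * (∑ i, partialDeriv i v x * partialDeriv i v x)
      + 2 * (∑ i, (x i - c i) * partialDeriv i v x) ^ 2)
    + τ * γ * (∑ i, partialDeriv i v x * partialDeriv i v x)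
    + τ ^ 3 * (sqDist c x - r) ^ 2 * sqDist c x
      * (2 * (sqDist c x - r) + 4 * sqDist c x - γ) * v x ^ 2
    - τ * n * (n + 2) * v x ^ 2 - τ ^ 2 * γ ^ 2 * v x ^ 2

section Weight

variable {n : ℕ} {i : Fin n} (τ r : ℝ) (c x : EuclideanSpace ℝ (Fin n))

theorem hasPartialDerivAt_sqDist_sub :
    HasPartialDerivAt i (fun y => sqDist c y - r) (2 * (x i - c i)) x :=
  ((hasPartialDerivAt_sum_sq c).sub (hasPartialDerivAt_const r)).congr_deriv (by ring)

theorem hasPartialDerivAt_weight :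
    HasPartialDerivAt i (weight τ r c)
      (weight τ r c x * (τ * (sqDist c x - r) * (x i - c i))) x :=
  (((hasPartialDerivAt_sqDist_sub r c x).mul
    (hasPartialDerivAt_sqDist_sub r c x)).const_mul (τ / 4)).exp.congr_deriv (by
      unfold weight; ring)

variable {u : EuclideanSpace ℝ (Fin n) → ℝ}

theorem partialDeriv_weight_mul (hu : ContDiff ℝ 2 u) :
    partialDeriv i (fun y => weight τ r c y * u y) x =
      weight τ r c x * (partialDeriv i u x + τ * (sqDist c x - r) * (x i - c i) * u x) :=
  (((hasPartialDerivAt_weight τ r c x).mul (hasPartialDerivAt_of_differentiableAt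
    (hu.differentiable (by norm_num) x))).congr_deriv (by ring)).partialDeriv_eq

theorem partialDeriv_partialDeriv_weight_mul (hu : ContDiff ℝ 2 u) :
    partialDeriv i (partialDeriv i (fun y => weight τ r c y * u y)) x =
      weight τ r c x * (partialDeriv i (partialDeriv i u) x
        + 2 * τ * (sqDist c x - r) * ((x i - c i) * partialDeriv i u x)
        + τ * (2 * ((x i - c i) * (x i - c i)) + (sqDist c x - r)) * u x
        + τ ^ 2 * (sqDist c x - r) ^ 2 * ((x i - c i) * (x i - c i)) * u x) := by
  have hfun : partialDeriv i (fun y => weight τ r c y * u y) = fun y =>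
      weight τ r c y * (partialDeriv i u y + τ * (sqDist c y - r) * (y i - c i) * u y) :=
    funext fun y => partialDeriv_weight_mul τ r c y hu
  rw [hfun]
  have h1 := hasPartialDerivAt_weight (i := i) τ r c x
  have h2 : HasPartialDerivAt i u _ x :=
    hasPartialDerivAt_of_differentiableAt (hu.differentiable (by norm_num) x)
  have h3 : HasPartialDerivAt i (partialDeriv i u) _ x :=
    hasPartialDerivAt_of_differentiableAt
      ((contDiff_partialDeriv (m := 1) hu (by norm_num)).differentiable (by norm_num) x)
  have h4 := hasPartialDerivAt_sqDist_sub (i := i) r c x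
  have h5 := hasPartialDerivAt_coord_sub (i := i) (x := x) c i
  rw [(h1.mul (h3.add ((h4.const_mul τ).mul h5 |>.mul h2))).partialDeriv_eq]
  simp only [if_true]
  ring

/-- The Laplacian, conjugated with the weight, is the sum of its shifted symmetric and
antisymmetric parts. -/
theorem weight_mul_euclideanLaplacian (hu : ContDiff ℝ 2 u) (γ : ℝ) :
    weight τ r c x * euclideanLaplacian u x =
      symmPart τ r γ c (fun y => weight τ r c y * u y) x
        + skewPart τ r γ c (fun y => weight τ r c y * u y) x := by
  rw [euclideanLaplacian_eq_sum_partialDeriv hu, symmPart, skewPart]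
  simp only [partialDeriv_partialDeriv_weight_mul τ r c x hu, partialDeriv_weight_mul τ r c x hu]
  have h1 : ∑ i, weight τ r c x * (partialDeriv i (partialDeriv i u) x
        + 2 * τ * (sqDist c x - r) * ((x i - c i) * partialDeriv i u x)
        + τ * (2 * ((x i - c i) * (x i - c i)) + (sqDist c x - r)) * u x
        + τ ^ 2 * (sqDist c x - r) ^ 2 * ((x i - c i) * (x i - c i)) * u x)
      = weight τ r c x * (∑ i, partialDeriv i (partialDeriv i u) x
        + 2 * τ * (sqDist c x - r) * ∑ i, (x i - c i) * partialDeriv i u x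
        + τ * (2 * sqDist c x + n * (sqDist c x - r)) * u x
        + τ ^ 2 * (sqDist c x - r) ^ 2 * sqDist c x * u x) := by
    rw [← Finset.mul_sum]
    simp only [Finset.sum_add_distrib, ← Finset.mul_sum, ← Finset.sum_mul]
    simp only [Finset.sum_const, Finset.card_univ, Fintype.card_fin, nsmul_eq_mul]
    rfl
  have h2 : ∑ i, (x i - c i) * (weight τ r c x * (partialDeriv i u x
        + τ * (sqDist c x - r) * (x i - c i) * u x))
      = weight τ r c x * (∑ i, (x i - c i) * partialDeriv i u x
        + τ * (sqDist c x - r) * sqDist c x * u x) := by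
    rw [sqDist, Finset.mul_sum, Finset.sum_mul, ← Finset.sum_add_distrib, Finset.mul_sum]
    refine Finset.sum_congr rfl fun i _ => ?_
    ring
  rw [h1, h2]
  ring

end Weight

/-- `symmPart * skewPart` and `carlemanForm` differ by the divergence of a compactly supported
vector field. -/
theorem integral_cross_sub_carlemanForm_eq_zero {n : ℕ} {v : EuclideanSpace ℝ (Fin n) → ℝ}
    (hv : ContDiff ℝ 2 v) (hc : HasCompactSupport v) (τ r γ : ℝ) (c : EuclideanSpace ℝ (Fin n)) :
    Integrable (fun x => symmPart τ r γ c v x * skewPart τ r γ c v x - carlemanForm τ r γ c v x) ∧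
    ∫ x, (symmPart τ r γ c v x * skewPart τ r γ c v x - carlemanForm τ r γ c v x) = 0 := by
  let F : Fin n → EuclideanSpace ℝ (Fin n) → ℝ := fun i x =>
    (-2 * τ) * (partialDeriv i v x * (sqDist c x - r) * ∑ j, (x j - c j) * partialDeriv j v x)
      + τ * ((sqDist c x - r) * (x i - c i) * ∑ j, partialDeriv j v x * partialDeriv j v x)
      - τ * ((n * (sqDist c x - r) + 2 * sqDist c x + γ) * v x * partialDeriv i v x)
      + (τ * (n + 2)) * ((x i - c i) * (v x * v x))
      - τ * ((τ ^ 2 * ((sqDist c x - r) * (sqDist c x - r) * sqDist c x) + τ * γ)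
        * (sqDist c x - r) * (x i - c i) * (v x * v x))
  have hp (i : Fin n) : ContDiff ℝ 1 (partialDeriv i v) := contDiff_partialDeriv hv (by norm_num)
  have hv1 : ContDiff ℝ 1 v := hv.of_le (by norm_num)
  have hF (i : Fin n) : ContDiff ℝ 1 (F i) := by
    have := contDiff_sqDist c (k := 1)
    simp only [F]
    fun_prop
  have hFc (i : Fin n) : HasCompactSupport (F i) := by
    refine hc.mono' fun x hx => ?_
    by_contra h
    simp [F, image_eq_zero_of_notMem_tsupport h, partialDeriv_eq_zero_of_notMem_tsupport h] at hx
  have hder (x : EuclideanSpace ℝ (Fin n)) := carleman_algebra (fun i => x i - c i)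
    (fun i => partialDeriv i v x) (fun i j => partialDeriv i (partialDeriv j v) x)
    (fun i j => partialDeriv_comm hv j) (v x) (sqDist c x - r) τ γ (sqDist c x) _ _ rfl rfl rfl
  have hFi (i : Fin n) (x : EuclideanSpace ℝ (Fin n)) := by
    have h1 : HasPartialDerivAt i v _ x :=
      hasPartialDerivAt_of_differentiableAt (hv1.differentiable (by norm_num) x)
    have h2 (j : Fin n) : HasPartialDerivAt i (partialDeriv j v) _ x :=
      hasPartialDerivAt_of_differentiableAt ((hp j).differentiable (by norm_num) x)
    have hs := hasPartialDerivAt_sqDist_sub (i := i) r c x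
    have hX : HasPartialDerivAt i (sqDist c) _ x := hasPartialDerivAt_sum_sq c
    have hy (j : Fin n) := hasPartialDerivAt_coord_sub (i := i) (x := x) c j
    have hN := HasPartialDerivAt.sum (s := Finset.univ) fun j _ => (h2 j).mul (h2 j)
    have hD := HasPartialDerivAt.sum (s := Finset.univ) fun j _ => (hy j).mul (h2 j)
    exact ((((((h2 i).mul hs).mul hD).const_mul (-2 * τ)).add
      (((hs.mul (hy i)).mul hN).const_mul τ)).sub
      ((((((hs.const_mul (n : ℝ)).add (hX.const_mul 2)).add (hasPartialDerivAt_const γ)).mul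
        h1).mul (h2 i)).const_mul τ)).add (((hy i).mul (h1.mul h1)).const_mul (τ * (n + 2))) |>.sub
      (((((((hs.mul hs).mul hX).const_mul (τ ^ 2)).add (hasPartialDerivAt_const (τ * γ))).mul
        hs).mul (hy i)).mul (h1.mul h1) |>.const_mul τ) |>.partialDeriv_eq
  have hint (i : Fin n) : Integrable (partialDeriv i (F i)) :=
    (contDiff_partialDeriv (m := 0) (hF i) (by simp)).continuous.integrable_of_hasCompactSupport
      (hasCompactSupport_partialDeriv (hFc i))
  have hsum : (fun x => symmPart τ r γ c v x * skewPart τ r γ c v x - carlemanForm τ r γ c v x) =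
      fun x => ∑ i, partialDeriv i (F i) x := by
    funext x
    refine (hder x).symm.trans ?_
    symm
    refine Finset.sum_congr rfl fun i _ => ?_
    refine (hFi i x).trans ?_
    have e1 : ∑ j, (partialDeriv i (partialDeriv j v) x * partialDeriv j v x
        + partialDeriv j v x * partialDeriv i (partialDeriv j v) x) =
        2 * ∑ j, partialDeriv j v x * partialDeriv i (partialDeriv j v) x := by
      rw [Finset.mul_sum]
      exact Finset.sum_congr rfl fun j _ => by ring
    have e2 : ∑ j, ((if j = i then 1 else 0) * partialDeriv j v x
        + (x j - c j) * partialDeriv i (partialDeriv j v) x) =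
        partialDeriv i v x + ∑ j, (x j - c j) * partialDeriv i (partialDeriv j v) x := by
      simp [Finset.sum_add_distrib]
    rw [e1, e2]
    simp only [if_true]
    ring
  constructor
  · rw [hsum]
    exact integrable_finsetSum _ fun i _ => hint i
  · rw [hsum, integral_finsetSum _ fun i _ => hint i]
    exact Finset.sum_eq_zero fun i _ => integral_partialDeriv_eq_zero (hF i) (hFc i)

theorem carlemanForm_lower_bound {n : ℕ} {v : EuclideanSpace ℝ (Fin n) → ℝ} {τ r r₀ r₁ K : ℝ}
    {c x : EuclideanSpace ℝ (Fin n)} (h₀ : 0 < r₀) (h₁ : r₁ < r) (h₂ : r < 2 * r₀) (hK : 0 ≤ K)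
    (hτ : 1 ≤ τ)
    (hτK : K + n * (n + 2) + (2 * (r - r₀)) ^ 2 ≤ τ * ((r - r₁) ^ 2 * r₀ * (8 * r₀ - 4 * r)))
    (hx₀ : r₀ ≤ sqDist c x) (hx₁ : sqDist c x ≤ r₁) :
    K * v x ^ 2 ≤ carlemanForm τ r (2 * (r - r₀)) c v x := by
  have hN : 0 ≤ ∑ i, partialDeriv i v x * partialDeriv i v x :=
    Finset.sum_nonneg fun i _ => mul_self_nonneg _
  unfold carlemanForm
  set N := ∑ i, partialDeriv i v x * partialDeriv i v x
  set D := ∑ i, (x i - c i) * partialDeriv i v x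
  set X := sqDist c x
  set m := (r - r₁) ^ 2 * r₀ * (8 * r₀ - 4 * r)
  have hτ0 : 0 < τ := by linarith
  have hm : m ≤ (X - r) ^ 2 * X * (2 * (X - r) + 4 * X - 2 * (r - r₀)) := by
    have e1 : (r - r₁) ^ 2 ≤ (X - r) ^ 2 := by nlinarith
    have e2 : (r - r₁) ^ 2 * r₀ ≤ (X - r) ^ 2 * X := by gcongr
    have e3 : 8 * r₀ - 4 * r ≤ 2 * (X - r) + 4 * X - 2 * (r - r₀) := by linarith
    have e4 : 0 ≤ 8 * r₀ - 4 * r := by linarith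
    exact mul_le_mul e2 e3 e4 (mul_nonneg (sq_nonneg _) (h₀.le.trans hx₀))
  have h_grad : 0 ≤ τ * N * (2 * (X - r) + 2 * (r - r₀)) :=
    mul_nonneg (mul_nonneg hτ0.le hN) (by linarith)
  have h_coef : K ≤ τ ^ 3 * m - τ * n * (n + 2) - τ ^ 2 * (2 * (r - r₀)) ^ 2 := by
    have hn : (0 : ℝ) ≤ n * (n + 2) := by positivity
    have e1 : τ ^ 2 * (K + n * (n + 2) + (2 * (r - r₀)) ^ 2) ≤ τ ^ 2 * (τ * m) := by gcongr
    have e2 : K ≤ τ ^ 2 * K := le_mul_of_one_le_left hK (one_le_pow₀ hτ)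
    have e3 : τ * (n * (n + 2)) ≤ τ ^ 2 * (n * (n + 2)) := by
      gcongr
      nlinarith
    linarith
  have h_zero : τ ^ 3 * m * v x ^ 2 ≤
      τ ^ 3 * ((X - r) ^ 2 * X * (2 * (X - r) + 4 * X - 2 * (r - r₀))) * v x ^ 2 := by
    gcongr
  have h_mul := mul_le_mul_of_nonneg_right h_coef (sq_nonneg (v x))
  have h_D : 0 ≤ 4 * τ * D ^ 2 := by positivity
  linarith

theorem euclideanLaplacian_eq_zero_of_notMem_tsupport {n : ℕ} {u : EuclideanSpace ℝ (Fin n) → ℝ}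
    {x : EuclideanSpace ℝ (Fin n)} (hx : x ∉ tsupport u) : euclideanLaplacian u x = 0 := by
  refine Finset.sum_eq_zero fun i _ => ?_
  have : iteratedFDeriv ℝ 2 u x = 0 := by
    by_contra h
    exact hx (support_iteratedFDeriv_subset 2 h)
  simp [this]

theorem continuous_euclideanLaplacian {n : ℕ} {u : EuclideanSpace ℝ (Fin n) → ℝ}
    (hu : ContDiff ℝ 2 u) : Continuous (euclideanLaplacian u) := by
  rw [show euclideanLaplacian u = _ from funext fun x => euclideanLaplacian_eq_sum_partialDeriv hu]
  refine continuous_finsetSum _ fun i _ => ?_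
  exact (contDiff_partialDeriv (m := 0) (contDiff_partialDeriv (m := 1) hu (by norm_num))
    (by simp)).continuous

theorem hasCompactSupport_euclideanLaplacian {n : ℕ} {u : EuclideanSpace ℝ (Fin n) → ℝ}
    (hc : HasCompactSupport u) : HasCompactSupport (euclideanLaplacian u) :=
  hc.mono' fun _ hx => by_contra fun h => hx (euclideanLaplacian_eq_zero_of_notMem_tsupport h)

theorem integrable_sq_of_hasCompactSupport {n : ℕ} {f : EuclideanSpace ℝ (Fin n) → ℝ}
    (hf : Continuous f) (hc : HasCompactSupport f) : Integrable fun x => f x ^ 2 :=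
  (hf.pow 2).integrable_of_hasCompactSupport <|
    hc.mono fun x hx h => hx (by simp [h])

/-- **Carleman estimate** for the Laplacian on functions supported in a thin annulus. -/
theorem carleman_estimate {n : ℕ} {u : EuclideanSpace ℝ (Fin n) → ℝ} (hu : ContDiff ℝ 2 u)
    (hc : HasCompactSupport u) {c : EuclideanSpace ℝ (Fin n)} {r r₀ r₁ K : ℝ}
    (h₀ : 0 < r₀) (h₁ : r₁ < r) (h₂ : r < 2 * r₀) (hK : 0 ≤ K)
    (hsupp : ∀ x ∈ tsupport u, r₀ ≤ sqDist c x ∧ sqDist c x ≤ r₁) :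
    ∃ τ₀ : ℝ, ∀ τ ≥ τ₀, K * ∫ x, (weight τ r c x * u x) ^ 2 ≤
      ∫ x, (weight τ r c x * euclideanLaplacian u x) ^ 2 := by
  have hm : 0 < (r - r₁) ^ 2 * r₀ * (8 * r₀ - 4 * r) :=
    mul_pos (mul_pos (pow_pos (by linarith) 2) h₀) (by linarith)
  refine ⟨max 1 ((K + n * (n + 2) + (2 * (r - r₀)) ^ 2) /
    ((r - r₁) ^ 2 * r₀ * (8 * r₀ - 4 * r))), fun τ hτ => ?_⟩
  have hτ1 : 1 ≤ τ := (le_max_left _ _).trans hτ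
  have hτK := (div_le_iff₀ hm).1 ((le_max_right _ _).trans hτ)
  have hw : ContDiff ℝ 2 (weight τ r c) := contDiff_weight τ r c
  set v : EuclideanSpace ℝ (Fin n) → ℝ := fun y => weight τ r c y * u y
  have hv2 : ContDiff ℝ 2 v := hw.mul hu
  have hvc : HasCompactSupport v := hc.mul_left
  obtain ⟨hint, hzero⟩ :=
    integral_cross_sub_carlemanForm_eq_zero hv2 hvc τ r (2 * (r - r₀)) c
  have hpt (x : EuclideanSpace ℝ (Fin n)) : K * v x ^ 2 ≤
      (weight τ r c x * euclideanLaplacian u x) ^ 2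
        - 4 * (symmPart τ r (2 * (r - r₀)) c v x * skewPart τ r (2 * (r - r₀)) c v x
          - carlemanForm τ r (2 * (r - r₀)) c v x) := by
    have hform : K * v x ^ 2 ≤ carlemanForm τ r (2 * (r - r₀)) c v x := by
      by_cases hx : x ∈ tsupport u
      · exact carlemanForm_lower_bound h₀ h₁ h₂ hK hτ1 hτK (hsupp x hx).1 (hsupp x hx).2
      · have hx' : x ∉ tsupport v := fun h => hx (tsupport_mul_subset_right h)
        simp [carlemanForm, image_eq_zero_of_notMem_tsupport hx',
          partialDeriv_eq_zero_of_notMem_tsupport hx']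
    have hKv : 0 ≤ K * v x ^ 2 := by positivity
    rw [weight_mul_euclideanLaplacian τ r c x hu (2 * (r - r₀))]
    nlinarith [sq_nonneg (symmPart τ r (2 * (r - r₀)) c v x - skewPart τ r (2 * (r - r₀)) c v x)]
  have hi1 : Integrable fun x => v x ^ 2 := integrable_sq_of_hasCompactSupport hv2.continuous hvc
  have hi2 : Integrable fun x => (weight τ r c x * euclideanLaplacian u x) ^ 2 :=
    integrable_sq_of_hasCompactSupport (hw.continuous.mul (continuous_euclideanLaplacian hu))
      (hasCompactSupport_euclideanLaplacian hc).mul_left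
  have hmono := integral_mono (hi1.const_mul K) (hi2.sub (hint.const_mul 4)) hpt
  rw [integral_const_mul] at hmono
  refine hmono.trans_eq ?_
  simp only [Pi.sub_apply]
  rw [integral_sub hi2 (hint.const_mul 4), integral_const_mul, hzero]
  simp

theorem weight_le_exp {n : ℕ} {τ r a : ℝ} {c x : EuclideanSpace ℝ (Fin n)} (hτ : 0 ≤ τ)
    (ha : a ≤ sqDist c x) (hr : sqDist c x ≤ r) :
    weight τ r c x ≤ Real.exp (τ / 4 * (r - a) ^ 2) := by
  refine Real.exp_le_exp.2 (mul_le_mul_of_nonneg_left ?_ (by positivity))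
  nlinarith

theorem exp_le_weight {n : ℕ} {τ r a : ℝ} {c x : EuclideanSpace ℝ (Fin n)} (hτ : 0 ≤ τ)
    (ha : sqDist c x ≤ a) (hr : a ≤ r) :
    Real.exp (τ / 4 * (r - a) ^ 2) ≤ weight τ r c x := by
  refine Real.exp_le_exp.2 (mul_le_mul_of_nonneg_left ?_ (by positivity))
  nlinarith

/-- If `|Δu| ≤ M |u|` where the squared distance to `c` is less than `b`, then the Carleman
estimate makes the mass of `u` within squared distance `a < b` decay in `τ`. -/
theorem integral_sq_le_exp_mul_integral {n : ℕ} {u ψ : EuclideanSpace ℝ (Fin n) → ℝ}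
    (hu : ContDiff ℝ 2 u) (hc : HasCompactSupport u) {c : EuclideanSpace ℝ (Fin n)}
    {r r₀ r₁ a b M : ℝ} (h₀ : 0 < r₀) (h₁ : r₁ < r) (h₂ : r < 2 * r₀) (har : a ≤ r)
    (hsupp : ∀ x ∈ tsupport u, r₀ ≤ sqDist c x ∧ sqDist c x ≤ r₁)
    (hψ : Continuous ψ) (hψ0 : ∀ x, 0 ≤ ψ x) (hψ1 : ∀ x, ψ x ≤ 1)
    (hψa : ∀ x, a ≤ sqDist c x → ψ x = 0)
    (hM : ∀ x, sqDist c x < b → |euclideanLaplacian u x| ≤ M * |u x|) :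
    ∃ τ₀ : ℝ, ∀ τ ≥ τ₀, ∫ x, (ψ x * u x) ^ 2 ≤
      Real.exp (-(τ * (((r - a) ^ 2 - (r - b) ^ 2) / 2))) * ∫ x, euclideanLaplacian u x ^ 2 := by
  obtain ⟨τ₀, hτ₀⟩ := carleman_estimate hu hc (K := M ^ 2 + 1) h₀ h₁ h₂ (by positivity) hsupp
  refine ⟨max τ₀ 0, fun τ hτ => ?_⟩
  have hτ0 : 0 ≤ τ := (le_max_right _ _).trans hτ
  have hcar := hτ₀ τ ((le_max_left _ _).trans hτ)
  have hwc : Continuous (weight τ r c) := (contDiff_weight (k := 0) τ _ c).continuous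
  have hL := continuous_euclideanLaplacian hu
  have hLc := hasCompactSupport_euclideanLaplacian hc
  have hi0 : Integrable fun x => (ψ x * u x) ^ 2 :=
    integrable_sq_of_hasCompactSupport (hψ.mul hu.continuous) hc.mul_left
  have hi1 : Integrable fun x => (weight τ r c x * u x) ^ 2 :=
    integrable_sq_of_hasCompactSupport (hwc.mul hu.continuous) hc.mul_left
  have hi2 : Integrable fun x => euclideanLaplacian u x ^ 2 :=
    integrable_sq_of_hasCompactSupport hL hLc
  have hi3 : Integrable fun x => (weight τ r c x * euclideanLaplacian u x) ^ 2 :=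
    integrable_sq_of_hasCompactSupport (hwc.mul hL) hLc.mul_left
  have hupper (x : EuclideanSpace ℝ (Fin n)) :
      (weight τ r c x * euclideanLaplacian u x) ^ 2 ≤ M ^ 2 * (weight τ r c x * u x) ^ 2
        + Real.exp (τ / 4 * (r - b) ^ 2) ^ 2 * euclideanLaplacian u x ^ 2 := by
    rw [mul_pow, mul_pow]
    rcases lt_or_ge (sqDist c x) b with hx | hx
    · have h1 : euclideanLaplacian u x ^ 2 ≤ M ^ 2 * u x ^ 2 := by
        rw [← sq_abs, ← sq_abs (u x), ← mul_pow]
        exact pow_le_pow_left₀ (abs_nonneg _) (hM x hx) 2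
      have h2 := mul_le_mul_of_nonneg_left h1 (sq_nonneg (weight τ r c x))
      have h3 : 0 ≤ Real.exp (τ / 4 * (r - b) ^ 2) ^ 2 * euclideanLaplacian u x ^ 2 := by
        positivity
      linarith
    · have h1 : 0 ≤ M ^ 2 * (weight τ r c x ^ 2 * u x ^ 2) := by positivity
      refine le_add_of_nonneg_of_le h1 ?_
      by_cases hxs : x ∈ tsupport u
      · have h2 : weight τ r c x ^ 2 ≤ Real.exp (τ / 4 * (r - b) ^ 2) ^ 2 :=
          pow_le_pow_left₀ (Real.exp_pos _).le
            (weight_le_exp hτ0 hx ((hsupp x hxs).2.trans h₁.le)) 2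
        exact mul_le_mul_of_nonneg_right h2 (sq_nonneg _)
      · simp [euclideanLaplacian_eq_zero_of_notMem_tsupport hxs]
  have hU := integral_mono hi3 ((hi1.const_mul (M ^ 2)).add (hi2.const_mul _)) hupper
  simp only [Pi.add_apply] at hU
  rw [integral_add (hi1.const_mul _) (hi2.const_mul _), integral_const_mul,
    integral_const_mul] at hU
  have hlower (x : EuclideanSpace ℝ (Fin n)) :
      Real.exp (τ / 4 * (r - a) ^ 2) ^ 2 * (ψ x * u x) ^ 2 ≤ (weight τ r c x * u x) ^ 2 := by
    rcases lt_or_ge (sqDist c x) a with hx | hx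
    · rw [← mul_pow, ← mul_assoc, mul_pow, mul_pow _ (u x)]
      refine mul_le_mul_of_nonneg_right (pow_le_pow_left₀ ?_ ?_ 2) (sq_nonneg _)
      · exact mul_nonneg (Real.exp_pos _).le (hψ0 x)
      · exact (mul_le_of_le_one_right (Real.exp_pos _).le (hψ1 x)).trans
          (exp_le_weight hτ0 hx.le har)
    · simpa [hψa x hx] using sq_nonneg _
  have hLow := integral_mono (hi0.const_mul _) hi1 hlower
  rw [integral_const_mul] at hLow
  have hE : Real.exp (-(τ * (((r - a) ^ 2 - (r - b) ^ 2) / 2)))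
      * Real.exp (τ / 4 * (r - a) ^ 2) ^ 2 = Real.exp (τ / 4 * (r - b) ^ 2) ^ 2 := by
    rw [← Real.exp_nat_mul, ← Real.exp_nat_mul, ← Real.exp_add]
    congr 1
    push_cast
    ring
  rw [← hE] at hU
  have hpos : 0 < Real.exp (τ / 4 * (r - a) ^ 2) ^ 2 := by positivity
  refine le_of_mul_le_mul_left ?_ hpos
  linarith

/-- A solution of `|Δw| ≤ M |w|` that vanishes on a ball vanishes on a slightly larger ball with
the same centre. -/
theorem eq_zero_of_eq_zero_on_smaller_ball {n : ℕ} {w : EuclideanSpace ℝ (Fin n) → ℝ}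
    {c : EuclideanSpace ℝ (Fin n)} {M ρ R : ℝ} (hw : ContDiffOn ℝ 2 w (ball c R))
    (hM : ∀ x ∈ ball c R, |euclideanLaplacian w x| ≤ M * |w x|) (hρ : 0 < ρ)
    (hR : R ^ 2 < 2 * ρ ^ 2) (h0 : ∀ x ∈ ball c ρ, w x = 0) :
    ∀ x ∈ ball c R, w x = 0 := by
  intro p hp
  by_contra hwp
  obtain ⟨R₀, hpR₀, hR₀⟩ := exists_between (mem_ball.1 hp)
  obtain ⟨R₁, hR₀₁, hR₁⟩ := exists_between hR₀
  obtain ⟨R₂, hR₁₂, hR₂⟩ := exists_between hR₁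
  have hR₀0 : 0 < R₀ := dist_nonneg.trans_lt hpR₀
  have hR₁0 : 0 < R₁ := hR₀0.trans hR₀₁
  let χ : ContDiffBump c := ⟨R₁, R₂, hR₁0, hR₁₂⟩
  let ψ : ContDiffBump c := ⟨R₀ / 2, R₀, by positivity, by linarith⟩
  set u : EuclideanSpace ℝ (Fin n) → ℝ := fun x => χ x * w x with hu_def
  have hsuppχ : ∀ x ∈ tsupport u, dist x c ≤ R₂ := fun x hx => by
    have := tsupport_mul_subset_left hx
    rwa [χ.tsupport_eq] at this
  have hu : ContDiff ℝ 2 u := by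
    refine contDiff_iff_contDiffAt.2 fun x => ?_
    by_cases hx : x ∈ ball c R
    · exact χ.contDiffAt.mul (hw.contDiffAt (isOpen_ball.mem_nhds hx))
    · have hx' : x ∉ tsupport u := fun h => hx ((hsuppχ x h).trans_lt hR₂)
      exact contDiffAt_const.congr_of_eventuallyEq (notMem_tsupport_iff_eventuallyEq.1 hx')
  have huc : HasCompactSupport u := χ.hasCompactSupport.mul_right
  have hsupp : ∀ x ∈ tsupport u, ρ ^ 2 ≤ sqDist c x ∧ sqDist c x ≤ R₂ ^ 2 := by
    intro x hx
    rw [sqDist_eq]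
    refine ⟨?_, pow_le_pow_left₀ dist_nonneg (hsuppχ x hx) 2⟩
    refine pow_le_pow_left₀ hρ.le ?_ 2
    by_contra! h
    refine notMem_tsupport_iff_eventuallyEq.2 ?_ hx
    filter_upwards [isOpen_ball.mem_nhds (mem_ball.2 h)] with y hy
    simp [hu_def, h0 y hy]
  have hMu : ∀ x, sqDist c x < R₁ ^ 2 → |euclideanLaplacian u x| ≤ M * |u x| := by
    intro x hx
    rw [sqDist_eq] at hx
    have hx' := lt_of_pow_lt_pow_left₀ 2 hR₁0.le hx
    have heq : u =ᶠ[𝓝 x] w := by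
      filter_upwards [χ.eventuallyEq_one_of_mem_ball (mem_ball.2 hx')] with y hy
      simp [hu_def, hy]
    have hlap : euclideanLaplacian u x = euclideanLaplacian w x :=
      Finset.sum_congr rfl fun i _ => by rw [(heq.iteratedFDeriv ℝ 2).eq_of_nhds]
    rw [hlap, heq.eq_of_nhds]
    exact hM x (mem_ball.2 (hx'.trans hR₁))
  have hψ0 : ∀ x, R₀ ^ 2 ≤ sqDist c x → ψ x = 0 := fun x hx => by
    rw [sqDist_eq] at hx
    exact ψ.zero_of_le_dist (le_of_sq_le_sq hx dist_nonneg)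
  obtain ⟨τ₀, hτ₀⟩ := integral_sq_le_exp_mul_integral hu huc (r := R ^ 2) (pow_pos hρ 2)
    (pow_lt_pow_left₀ hR₂ (by linarith) two_ne_zero) hR
    (pow_le_pow_left₀ hR₀0.le hR₀.le 2) hsupp ψ.continuous (fun x => ψ.nonneg)
    (fun x => ψ.le_one) hψ0 hMu
  have hJ : 0 < ∫ x, (ψ x * u x) ^ 2 := by
    refine ((ψ.continuous.mul hu.continuous).pow
      2).integral_pos_of_hasCompactSupport_nonneg_nonzero
      (huc.mono fun x hx h => hx (by simp [h])) (fun x => sq_nonneg _) (x := p) ?_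
    have h1 : χ p = 1 := χ.one_of_mem_closedBall (mem_closedBall.2 (hpR₀.trans hR₀₁).le)
    have h2 : 0 < ψ p := ψ.pos_of_mem_ball hpR₀
    simp [hu_def, h1, h2.ne', hwp]
  have hBA : (R ^ 2 - R₁ ^ 2) ^ 2 < (R ^ 2 - R₀ ^ 2) ^ 2 := by
    have e1 : R₀ ^ 2 < R₁ ^ 2 := pow_lt_pow_left₀ hR₀₁ hR₀0.le two_ne_zero
    have e2 : R₁ ^ 2 < R ^ 2 := pow_lt_pow_left₀ hR₁ hR₁0.le two_ne_zero
    exact pow_lt_pow_left₀ (by linarith) (by linarith) two_ne_zero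
  have hlim := (Real.tendsto_exp_neg_atTop_nhds_zero.comp
    (tendsto_id.atTop_mul_const (half_pos (sub_pos.2 hBA)))).mul_const
      (∫ x, euclideanLaplacian u x ^ 2)
  have := ge_of_tendsto hlim (eventually_atTop.2 ⟨τ₀, hτ₀⟩)
  linarith

/-- A solution of `|Δw| ≤ M |w|` on a ball that vanishes near the centre vanishes. -/
theorem eq_zero_on_ball {n : ℕ} {w : EuclideanSpace ℝ (Fin n) → ℝ}
    {c : EuclideanSpace ℝ (Fin n)} {M ρ R : ℝ} (hw : ContDiffOn ℝ 2 w (ball c R))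
    (hM : ∀ x ∈ ball c R, |euclideanLaplacian w x| ≤ M * |w x|) (hρ : 0 < ρ)
    (h0 : ∀ x ∈ ball c ρ, w x = 0) : ∀ x ∈ ball c R, w x = 0 := by
  rcases le_or_gt R 0 with hR | hR
  · simp [ball_eq_empty.2 hR]
  have key (k : ℕ) : ∀ x ∈ ball c (min (ρ * (5 / 4) ^ k) R), w x = 0 := by
    induction k with
    | zero => exact fun x hx => h0 x (ball_subset_ball (by simp) hx)
    | succ k ih =>
      have hsub : ball c (min (ρ * (5 / 4) ^ (k + 1)) R) ⊆ ball c R :=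
        ball_subset_ball (min_le_right _ _)
      have hmin : 0 < min (ρ * (5 / 4) ^ k) R := lt_min (by positivity) hR
      have hle : min (ρ * (5 / 4) ^ (k + 1)) R ≤ 5 / 4 * min (ρ * (5 / 4) ^ k) R := by
        rw [mul_min_of_nonneg _ _ (by norm_num)]
        exact min_le_min (by rw [pow_succ]; linarith) (by linarith)
      refine eq_zero_of_eq_zero_on_smaller_ball (hw.mono hsub) (fun x hx => hM x (hsub hx))
        hmin ?_ ih
      have h1 : 0 < min (ρ * (5 / 4) ^ (k + 1)) R := lt_min (by positivity) hR
      nlinarith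
  obtain ⟨k, hk⟩ := pow_unbounded_of_one_lt (R / ρ) (by norm_num : (1 : ℝ) < 5 / 4)
  have hle : R ≤ ρ * (5 / 4) ^ k := by
    rw [div_lt_iff₀ hρ] at hk
    linarith
  simpa [min_eq_right hle] using key k

end UniqueContinuation

/-- **Strong unique continuation, Euclidean case.**
A `C²` solution of the uniformly elliptic linear equation `a·Δw + b·w = 0` on
an open connected set `U ⊆ ℝⁿ`, with `a` of class `C¹` and `a ≥ δ > 0` and `b`
continuous and bounded, that vanishes identically on a nonempty open subset
`V ⊆ U`, vanishes identically on `U`. -/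
theorem strong_unique_continuation_euclidean {n : ℕ}
    (U : Set (EuclideanSpace ℝ (Fin n)))
    (hUopen : IsOpen U) (hUconn : IsConnected U)
    (δ : ℝ) (hδ : 0 < δ)
    (a b : EuclideanSpace ℝ (Fin n) → ℝ)
    (ha : ContDiffOn ℝ 1 a U) (haδ : ∀ x ∈ U, δ ≤ a x)
    (hb : ContinuousOn b U) (hbbdd : ∃ C : ℝ, ∀ x ∈ U, |b x| ≤ C)
    (w : EuclideanSpace ℝ (Fin n) → ℝ)
    (hw : ContDiffOn ℝ 2 w U)
    (heq : ∀ x ∈ U, a x * euclideanLaplacian w x + b x * w x = 0)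
    (V : Set (EuclideanSpace ℝ (Fin n)))
    (hVopen : IsOpen V) (hVne : V.Nonempty) (hVU : V ⊆ U)
    (hwV : ∀ x ∈ V, w x = 0) :
    ∀ x ∈ U, w x = 0 := by
  obtain ⟨C, hC⟩ := hbbdd
  have hM : ∀ x ∈ U, |euclideanLaplacian w x| ≤ C / δ * |w x| := by
    intro x hx
    have h1 : a x * |euclideanLaplacian w x| = |b x| * |w x| := by
      rw [← abs_mul, ← abs_neg (b x * w x), ← eq_neg_of_add_eq_zero_left (heq x hx), abs_mul,
        abs_of_pos (hδ.trans_le (haδ x hx))]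
    rw [div_mul_eq_mul_div, le_div_iff₀ hδ, mul_comm]
    calc δ * |euclideanLaplacian w x| ≤ a x * |euclideanLaplacian w x| := by
          gcongr
          exact haδ x hx
      _ = |b x| * |w x| := h1
      _ ≤ C * |w x| := by
          gcongr
          exact hC x hx
  suffices h : U ⊆ interior {x | w x = 0} from
    fun x hx => interior_subset (s := {x | w x = 0}) (h hx)
  refine hUconn.isPreconnected.subset_of_closure_inter_subset isOpen_interior ?_ ?_
  · obtain ⟨x, hx⟩ := hVne
    exact ⟨x, hVU hx, mem_interior.2 ⟨V, hwV, hVopen, hx⟩⟩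
  · rintro p ⟨hp, hpU⟩
    obtain ⟨r, hr, hrU⟩ := Metric.isOpen_iff.1 hUopen p hpU
    obtain ⟨z, hz, hpz⟩ := Metric.mem_closure_iff.1 hp (r / 2) (by positivity)
    obtain ⟨ρ, hρ, hρ0⟩ := Metric.isOpen_iff.1 isOpen_interior z hz
    have hsub : Metric.ball z (r / 2) ⊆ U := fun x hx => hrU <| by
      rw [Metric.mem_ball] at hx ⊢
      linarith [dist_triangle x z p, dist_comm p z]
    have h0 := UniqueContinuation.eq_zero_on_ball (hw.mono hsub) (fun x hx => hM x (hsub hx)) hρ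
      fun x hx => interior_subset (s := {x | w x = 0}) (hρ0 hx)
    exact mem_interior.2 ⟨_, h0, Metric.isOpen_ball, hpz⟩
end
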